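/- arXiv:math/0006021 — 5 statements merged into one kernel-verified Lean document; each statement's English description precedes it below -/
import Mathlib

section
/- Let k ≥ 2 and n = 3k. For every choice of generic eigenvalues compatible with the triple of multiplicity vectors C_k : Λ₁ = (k,k,k), Λ₂ = (k,k,k), Λ₃ = (k+1, k, k−1), there exists an irreducible triple of diagonalizable matrices A₁, A₂, A₃ ∈ gl(n,ℂ) with A₁ + A₂ + A₃ = 0, where A_j has distinct eigenvalues with multiplicities given by Λ_j equal to the chosen generic eigenvalues. (This triple of multiplicity vectors is rigid: d₁ + d₂ + d₃ = 2n² − 2.) -/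
open Matrix BigOperators

/-- `B` lies in the conjugacy class of `A` (conjugation by an invertible matrix). -/
def MatConj {n : ℕ} (A B : Matrix (Fin n) (Fin n) ℂ) : Prop :=
  ∃ S : (Matrix (Fin n) (Fin n) ℂ)ˣ, B = S.val * A * (S⁻¹).val

/-- A tuple of `n × n` matrices is irreducible if no subspace of `ℂⁿ` other than `⊥` and `⊤`
is invariant under all of them. -/
def IrreducibleTuple {q n : ℕ} (M : Fin q → Matrix (Fin n) (Fin n) ℂ) : Prop :=
  ∀ V : Submodule ℂ (Fin n → ℂ),
    (∀ j, V.map (Matrix.mulVecLin (M j)) ≤ V) → V = ⊥ ∨ V = ⊤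

/-- The multiset of multiplicities of the distinct values of `d : Fin n → ℂ`
(the multiplicity vector of the diagonal matrix with diagonal `d`). -/
noncomputable def evCounts {n : ℕ} (d : Fin n → ℂ) : Multiset ℕ := by
  classical exact (Finset.univ.image d).val.map fun σ => (Finset.univ.filter fun k => d k = σ).card

/-- Genericity of the eigenvalue families `d j` (eigenvalues listed with multiplicity):
no partial sums, with `κ` eigenvalues chosen from each family, `1 ≤ κ ≤ n-1`, vanish. -/
def GenericAddEV {q n : ℕ} (d : Fin q → Fin n → ℂ) : Prop :=
  ∀ κ : ℕ, 1 ≤ κ → κ ≤ n - 1 →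
    ∀ Φ : Fin q → Finset (Fin n), (∀ j, (Φ j).card = κ) →
      (∑ j, ∑ k ∈ Φ j, d j k) ≠ 0

open Module in
/-- `T` has an eigenbasis with multiset of eigenvalues `S`. -/
def EigMul {V : Type} [AddCommGroup V] [Module ℂ V] (T : Module.End ℂ V) (S : Multiset ℂ) : Prop :=
  ∃ (ι : Type) (_ : Fintype ι) (b : Module.Basis ι ℂ V) (v : ι → ℂ),
    (Finset.univ : Finset ι).val.map v = S ∧ ∀ i, T (b i) = v i • b i

/-- Solvability of the additive problem for given multisets of eigenvalues. -/
def SolMul (S : Fin 3 → Multiset ℂ) : Prop :=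
  ∃ (V : Type) (_ : AddCommGroup V) (_ : Module ℂ V) (T : Fin 3 → Module.End ℂ V),
    (∑ j, T j) = 0 ∧ ∀ j, EigMul (T j) (S j)

theorem equiv_of_map_eq {α β : Type} [Fintype α] [Fintype β] (v : α → ℂ) (d : β → ℂ)
    (h : (Finset.univ : Finset α).val.map v = (Finset.univ : Finset β).val.map d) :
    ∃ e : α ≃ β, ∀ i, d (e i) = v i := by
  classical
  have hc : ∀ y, Fintype.card {i // v i = y} = Fintype.card {i // d i = y} := by
    intro y
    have := congrArg (Multiset.count y) h
    rw [Multiset.count_map, Multiset.count_map] at this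
    rw [Fintype.card_subtype, Fintype.card_subtype]
    simpa [Finset.card, Finset.filter, eq_comm] using this
  let e := (Equiv.sigmaFiberEquiv v).symm.trans
    ((Equiv.sigmaCongrRight (fun y => Fintype.equivOfCardEq (hc y))).trans
      (Equiv.sigmaFiberEquiv d))
  refine ⟨e, fun i => ?_⟩
  exact ((Fintype.equivOfCardEq (hc (v i))) ⟨i, rfl⟩).2

theorem exists_finset_of_le_map {n : ℕ} (d : Fin n → ℂ) (T : Multiset ℂ)
    (h : T ≤ (Finset.univ : Finset (Fin n)).val.map d) :
    ∃ Φ : Finset (Fin n), Φ.card = T.card ∧ ∑ i ∈ Φ, d i = T.sum := by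
  have key : ∃ u : Multiset (Fin n), u ≤ Finset.univ.val ∧ u.map d = T := by
    generalize (Finset.univ : Finset (Fin n)).val = s at h
    induction s using Quotient.inductionOn with
    | _ l =>
    induction T using Quotient.inductionOn with
    | _ t =>
    simp only [Multiset.quot_mk_to_coe, Multiset.map_coe, Multiset.coe_le] at h ⊢
    obtain ⟨t', ht', hs⟩ := h
    obtain ⟨l', hl', rfl⟩ := List.sublist_map_iff.1 hs
    exact ⟨l', Multiset.coe_le.2 hl'.subperm, by simpa using ht'⟩
  obtain ⟨u, hu, rfl⟩ := key
  refine ⟨⟨u, Multiset.nodup_of_le hu Finset.univ.nodup⟩, by simp [Finset.card], rfl⟩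

theorem eigbasis_of_factor {V ρ : Type} [AddCommGroup V] [Module ℂ V] [FiniteDimensional ℂ V]
    [Fintype ρ] [DecidableEq ρ] (P : (ρ → ℂ) →ₗ[ℂ] V) (Q : V →ₗ[ℂ] (ρ → ℂ)) (v : ρ → ℂ)
    (hv : ∀ r, v r ≠ 0) (hQP : ∀ u r, Q (P u) r = v r * u r) (m : ℕ)
    (hm : m + Fintype.card ρ = Module.finrank ℂ V) :
    ∃ b : Module.Basis (Fin m ⊕ ρ) ℂ V, (∀ i, P (Q (b (Sum.inl i))) = 0) ∧
      ∀ r, P (Q (b (Sum.inr r))) = v r • b (Sum.inr r) := by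
  have hsurj : Function.Surjective Q := by
    intro w
    refine ⟨P (fun r => (v r)⁻¹ * w r), ?_⟩
    ext r
    rw [hQP, mul_inv_cancel_left₀ (hv r)]
  have hk : Module.finrank ℂ (LinearMap.ker Q) = m := by
    have := LinearMap.finrank_range_add_finrank_ker Q
    rw [LinearMap.range_eq_top.2 hsurj, finrank_top, Module.finrank_fintype_fun_eq_card] at this
    omega
  let bK := Module.finBasisOfFinrankEq ℂ (LinearMap.ker Q) hk
  let w : Fin m ⊕ ρ → V := Sum.elim (fun i => (bK i : V)) (fun r => P (Pi.single r 1))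
  have hw : LinearIndependent ℂ w := by
    rw [Fintype.linearIndependent_iff]
    intro g hg
    rw [Fintype.sum_sum_type] at hg
    simp only [w, Sum.elim_inl, Sum.elim_inr] at hg
    have e2 : ∑ r, g (Sum.inr r) • P (Pi.single r 1) = P (fun r => g (Sum.inr r)) := by
      conv_rhs => rw [pi_eq_sum_univ' (fun r => g (Sum.inr r))]
      simp [map_sum, Pi.single]
    have e1 : ∑ i, g (Sum.inl i) • (bK i : V) = ((∑ i, g (Sum.inl i) • bK i : LinearMap.ker Q) : V) := by
      simp
    have h2 : ∀ r, g (Sum.inr r) = 0 := by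
      intro r
      have := congrArg (fun x => Q x r) hg
      simp only [map_add] at this
      rw [e2, e1, LinearMap.mem_ker.1 (Subtype.mem _)] at this
      simp [hQP, hv] at this
      exact this
    have h1 : ∀ i, g (Sum.inl i) = 0 := by
      simp only [h2, zero_smul, Finset.sum_const_zero, add_zero] at hg
      rw [e1] at hg
      exact Fintype.linearIndependent_iff.1 bK.linearIndependent _ (by exact_mod_cast hg)
    rintro (i | r)
    · exact h1 i
    · exact h2 r
  let b := basisOfLinearIndependentOfCardEqFinrank' w hw (by simpa using hm)
  have hb : ∀ i, b i = w i := fun i => by simp [b]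
  refine ⟨b, fun i => ?_, fun r => ?_⟩
  · rw [hb]
    have : Q (w (Sum.inl i)) = 0 := LinearMap.mem_ker.1 (bK i).2
    rw [this, map_zero]
  · rw [hb]
    have : Q (w (Sum.inr r)) = v r • Pi.single r 1 := by
      ext r'
      simp only [w, Sum.elim_inr, hQP, Pi.smul_apply, smul_eq_mul]
      by_cases h : r' = r
      · subst h; rfl
      · simp [h]
    rw [this, map_smul]
    rfl

/-- The reflection (middle convolution) step at the central vertex. -/
theorem refl_core {V : Type} [AddCommGroup V] [Module ℂ V] [FiniteDimensional ℂ V]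
    (B : Fin 3 → Module.End ℂ V) (s : ℂ) (hs : s ≠ 0) (hB : ∑ j, B j = s • 1)
    (ι : Fin 3 → Type) [∀ j, Fintype (ι j)] (b : ∀ j, Module.Basis (ι j) ℂ V)
    (v : ∀ j, ι j → ℂ) (hbv : ∀ j i, B j (b j i) = v j i • b j i)
    (hvs : ∀ j i, v j i ≠ 0 → v j i - s ≠ 0) (m : Fin 3 → ℕ)
    [∀ j, Fintype {i : ι j // v j i ≠ 0}]
    (hm : ∀ j, m j + Fintype.card {i : ι j // v j i ≠ 0} + Module.finrank ℂ V =
      ∑ j, Fintype.card {i : ι j // v j i ≠ 0}) :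
    ∃ (V' : Type) (_ : AddCommGroup V') (_ : Module ℂ V') (B' : Fin 3 → Module.End ℂ V'),
      ∑ j, B' j = (-s) • 1 ∧
      ∀ j, ∃ b' : Module.Basis (Fin (m j) ⊕ {i : ι j // v j i ≠ 0}) ℂ V',
        (∀ i, B' j (b' (Sum.inl i)) = 0) ∧
        ∀ r, B' j (b' (Sum.inr r)) = (v j r.1 - s) • b' (Sum.inr r) := by
  classical
  let ρ : Fin 3 → Type := fun j => {i : ι j // v j i ≠ 0}
  let Pj : ∀ j, (ρ j → ℂ) →ₗ[ℂ] V := fun j => Fintype.linearCombination ℂ (fun r : ρ j => b j r.1)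
  let Qj : ∀ j, V →ₗ[ℂ] (ρ j → ℂ) := fun j => LinearMap.pi (fun r => v j r.1 • (b j).coord r.1)
  have hPj : ∀ j u, Pj j u = ∑ r, u r • b j r.1 := fun j u => rfl
  have hQj : ∀ j x r, Qj j x r = v j r.1 * (b j).repr x r.1 := fun j x r => rfl
  have hPQj : ∀ j x, Pj j (Qj j x) = B j x := by
    intro j
    have : (Pj j).comp (Qj j) = B j := by
      apply (b j).ext
      intro i
      rw [LinearMap.comp_apply, hPj, hbv]
      by_cases hi : v j i = 0
      · rw [hi, zero_smul]
        apply Finset.sum_eq_zero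
        intro r _
        have : r.1 ≠ i := fun h => r.2 (h ▸ hi)
        simp [hQj, this.symm]
      · rw [Finset.sum_eq_single (⟨i, hi⟩ : ρ j)]
        · simp [hQj]
        · intro r _ hr
          have : r.1 ≠ i := fun h => hr (Subtype.ext h)
          simp [hQj, this.symm]
        · simp
    intro x
    rw [← this]; rfl
  have hQPj : ∀ j u r, Qj j (Pj j u) r = v j r.1 * u r := by
    intro j u r
    rw [hQj, hPj, map_sum, Finsupp.finsetSum_apply, Finset.sum_eq_single r]
    · simp
    · intro r' _ hr
      have : r'.1 ≠ r.1 := fun h => hr (Subtype.ext h)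
      simp [this]
    · simp
  let P : (∀ j, ρ j → ℂ) →ₗ[ℂ] V := ∑ j, (Pj j).comp (LinearMap.proj j)
  let Q : V →ₗ[ℂ] (∀ j, ρ j → ℂ) := LinearMap.pi Qj
  have hP : ∀ w, P w = ∑ j, Pj j (w j) := fun w => by simp [P]
  have hPQ : ∀ x, P (Q x) = s • x := by
    intro x
    rw [hP]
    have := congrArg (fun f : Module.End ℂ V => f x) hB
    simp only [LinearMap.sum_apply] at this
    rw [← Finset.sum_congr rfl (fun j _ => hPQj j x)] at this
    simpa [Q] using this
  have hsurj : Function.Surjective P := fun x => ⟨s⁻¹ • Q x, by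
    rw [map_smul, hPQ, smul_smul, inv_mul_cancel₀ hs, one_smul]⟩
  have hfin : Module.finrank ℂ (LinearMap.ker P) + Module.finrank ℂ V =
      ∑ j, Fintype.card (ρ j) := by
    have := LinearMap.finrank_range_add_finrank_ker P
    rw [LinearMap.range_eq_top.2 hsurj, finrank_top] at this
    have h2 : Module.finrank ℂ (∀ j, ρ j → ℂ) = ∑ j, Fintype.card (ρ j) := by
      simp [Module.finrank_pi_fintype]
    omega
  let Pr : (∀ j, ρ j → ℂ) →ₗ[ℂ] LinearMap.ker P := LinearMap.codRestrict _ (Q.comp P - s • LinearMap.id) (by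
    intro w
    simp [LinearMap.mem_ker, hPQ])
  have hPr : ∀ w, ((Pr w : LinearMap.ker P) : (∀ j, ρ j → ℂ)) = Q (P w) - s • w := fun w => rfl
  let P' : ∀ j, (ρ j → ℂ) →ₗ[ℂ] LinearMap.ker P := fun j => Pr.comp (LinearMap.single ℂ (fun j => ρ j → ℂ) j)
  let Q' : ∀ j, LinearMap.ker P →ₗ[ℂ] (ρ j → ℂ) := fun j =>
    (LinearMap.proj j).comp (LinearMap.ker P).subtype
  refine ⟨LinearMap.ker P, inferInstance, inferInstance, fun j => (P' j).comp (Q' j), ?_, ?_⟩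
  · ext1 w
    have h1 : ∑ j, (LinearMap.single ℂ (fun j => ρ j → ℂ) j) ((w : (∀ j, ρ j → ℂ)) j) = (w : (∀ j, ρ j → ℂ)) := by
      simpa using Finset.univ_sum_single (w : (∀ j, ρ j → ℂ))
    have h2 : (∑ j, (P' j).comp (Q' j)) w = Pr (w : (∀ j, ρ j → ℂ)) := by
      conv_rhs => rw [← h1, map_sum]
      rw [LinearMap.sum_apply]
      rfl
    rw [h2]
    apply Subtype.ext
    rw [hPr, LinearMap.mem_ker.1 w.2]
    simp
  · intro j
    refine eigbasis_of_factor (P' j) (Q' j) (fun r : ρ j => v j r.1 - s) (fun r => hvs j r.1 r.2)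
      ?_ (m j) ?_
    · intro u r
      change (Pr (Pi.single j u) : (∀ j, ρ j → ℂ)) j r = _
      rw [hPr]
      have : P (Pi.single j u) = Pj j u := by
        rw [hP, Finset.sum_eq_single j]
        · simp
        · intro i _ hi
          simp [hi]
        · simp
      rw [this]
      change Qj j (Pj j u) r - s * (Pi.single j u : (∀ j, ρ j → ℂ)) j r = _
      rw [hQPj]
      simp
      ring
    · have := hm j
      have e : ∀ j, Fintype.card (ρ j) = Fintype.card {i : ι j // v j i ≠ 0} :=
        fun j => Fintype.card_congr (Equiv.refl _)
      simp only [e] at hfin ⊢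
      omega

theorem katz (c : Fin 3 → ℂ) (m m' : Fin 3 → ℕ) (R : Fin 3 → Multiset ℂ) (N N' : ℕ) (σ : ℂ)
    (hσ : σ = ∑ j, c j) (hσ0 : σ ≠ 0) (hN : ∀ j, m j + (R j).card = N)
    (hN' : ∀ j, m' j + (R j).card = N') (hNN : N + N' = ∑ j, (R j).card)
    (h1 : ∀ j, ∀ x ∈ R j, x - c j ≠ 0) (h2 : ∀ j, ∀ x ∈ R j, x - c j + σ ≠ 0)
    (h : SolMul (fun j => Multiset.replicate (m' j) (c j - 2 * σ / 3) + (R j).map (· + σ / 3))) :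
    SolMul (fun j => Multiset.replicate (m j) (c j) + R j) := by
  classical
  obtain ⟨V, _, _, T, hT, hE⟩ := h
  choose ι hι b v hv hb using hE
  let B : Fin 3 → Module.End ℂ V := fun j => T j - (c j - 2 * σ / 3) • 1
  let u : ∀ j, ι j → ℂ := fun j i => v j i - (c j - 2 * σ / 3)
  have hfin : FiniteDimensional ℂ V := (b 0).finiteDimensional_of_finite
  have hB : ∑ j, B j = σ • 1 := by
    simp only [B, Finset.sum_sub_distrib, hT, ← Finset.sum_smul, ← hσ, zero_sub, ← neg_smul]
    congr 1
    simp
    ring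
  have hR : ∀ j, (Finset.univ : Finset {i : ι j // u j i ≠ 0}).val.map (fun r => v j r.1 - σ / 3) = R j := by
    intro j
    have e0 : (Finset.univ : Finset {i : ι j // u j i ≠ 0}).val.map (fun r => v j r.1) =
        ((Finset.univ : Finset (ι j)).val.filter (fun i => u j i ≠ 0)).map (v j) := by
      have : (Finset.univ : Finset {i : ι j // u j i ≠ 0}).val.map (fun r => r.1) =
        (Finset.univ : Finset (ι j)).val.filter (fun i => u j i ≠ 0) := by
        have := congrArg Finset.val (Finset.subtype_map (s := (Finset.univ : Finset (ι j))) (fun i => u j i ≠ 0))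
        simpa using this
      rw [← this, Multiset.map_map]
      rfl
    have e1 : ((Finset.univ : Finset (ι j)).val.filter (fun i => u j i ≠ 0)).map (v j) =
        ((Finset.univ : Finset (ι j)).val.map (v j)).filter (fun x => x - (c j - 2 * σ / 3) ≠ 0) := by
      rw [Multiset.filter_map]; rfl
    have e2 : ((Finset.univ : Finset (ι j)).val.map (v j)).filter (fun x => x - (c j - 2 * σ / 3) ≠ 0)
        = (R j).map (· + σ / 3) := by
      rw [hv, Multiset.filter_add, Multiset.filter_eq_nil.2, zero_add, Multiset.filter_eq_self.2]
      · intro x hx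
        obtain ⟨y, hy, rfl⟩ := Multiset.mem_map.1 hx
        have := h2 j y hy
        intro h
        apply this
        linear_combination h
      · intro x hx
        rw [Multiset.eq_of_mem_replicate hx]
        simp
    have e3 := congrArg (Multiset.map (fun x => x - σ / 3)) (e0.trans (e1.trans e2))
    rw [Multiset.map_map, Multiset.map_map] at e3
    simpa [Function.comp_def] using e3
  have hcard : ∀ j, Fintype.card {i : ι j // u j i ≠ 0} = (R j).card := by
    intro j
    rw [← hR j, Multiset.card_map]; rfl
  have hdim : Module.finrank ℂ V = N' := by
    rw [Module.finrank_eq_card_basis (b 0), ← hN' 0]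
    have := congrArg Multiset.card (hv 0)
    simpa using this
  obtain ⟨V', _, _, B', hB', hE'⟩ := refl_core B σ hσ0 hB ι b u
    (by
      intro j i
      simp [B, u, hb, sub_smul])
    (by
      intro j i hi
      have : v j i - σ / 3 ∈ R j := by
        rw [← hR j]
        exact Multiset.mem_map.2 ⟨⟨i, hi⟩, Finset.mem_univ _, rfl⟩
      have := h1 j _ this
      intro h
      apply this
      simp only [u] at h
      linear_combination h)
    m (by
      intro j
      simp only [hcard, hdim]
      have := hN j
      omega)
  refine ⟨V', inferInstance, inferInstance, fun j => B' j + (c j) • 1, ?_, ?_⟩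
  · rw [Finset.sum_add_distrib, hB', ← Finset.sum_smul, ← hσ, neg_smul, neg_add_cancel]
  · intro j
    obtain ⟨b', hb1, hb2⟩ := hE' j
    refine ⟨_, inferInstance, b', Sum.elim (fun _ => c j) (fun r => v j r.1 - σ / 3), ?_, ?_⟩
    · rw [← Finset.univ_disjSum_univ, Finset.val_disjSum, Multiset.disjSum, Multiset.map_add,
        Multiset.map_map, Multiset.map_map]
      congr 1
      · simp [Function.comp_def, Multiset.map_const']
      · simpa [Function.comp_def] using hR j
    · rintro (i | r)
      · simp [hb1]
      · simp only [LinearMap.add_apply, hb2, Sum.elim_inr, LinearMap.smul_apply, Module.End.one_apply, u,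
          ← add_smul]
        congr 1
        ring

theorem mem_two {a b : ℕ} {x y w : ℂ} (h : w ∈ Multiset.replicate a x + Multiset.replicate b y) :
    w = x ∨ w = y := by
  rcases Multiset.mem_add.1 h with h | h
  · exact Or.inl (Multiset.eq_of_mem_replicate h)
  · exact Or.inr (Multiset.eq_of_mem_replicate h)

/-- The arithmetic genericity conditions (on one arm) used along the induction. -/
def ArmGen (k : ℕ) (D σ p q : ℂ) : Prop :=
  ∀ m : ℕ, m < k → σ + m * D ≠ 0 ∧ p - m * D ≠ 0 ∧ q - m * D ≠ 0 ∧ q - p - m * D ≠ 0 ∧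
    σ + p + m * D ≠ 0 ∧ (m + 1 < k → σ + q + m * D ≠ 0) ∧ q - p - σ - (k - 1) * D - m * D ≠ 0

theorem ArmGen.next {k : ℕ} {D σ p q : ℂ} (h : ArmGen (k + 2) D σ p q) :
    ArmGen (k + 1) D (σ + D) (-q - σ) (p - q + (k + 1) * D) := by
  intro m hm
  refine ⟨fun e => ?_, fun e => ?_, fun e => ?_, fun e => ?_, fun e => ?_, fun hm' e => ?_, fun e => ?_⟩
  · apply (h (m + 1) (by omega)).1
    push_cast; linear_combination e
  · apply (h m (by omega)).2.2.2.2.2.1 (by omega)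
    linear_combination -e
  · apply (h (k + 1 - m) (by omega)).2.2.2.1
    rw [Nat.cast_sub (by omega)]
    push_cast; linear_combination -e
  · apply (h (k + 1 - m) (by omega)).2.2.2.2.1
    rw [Nat.cast_sub (by omega)]
    push_cast; linear_combination e
  · apply (h (m + 1) (by omega)).2.2.1
    push_cast; linear_combination -e
  · apply (h (m + 1) (by omega)).2.2.2.2.2.2
    push_cast; linear_combination -e
  · apply (h m (by omega)).2.1
    push_cast at e
    linear_combination e

theorem sol_single (y : Fin 3 → ℂ) (hy : ∑ j, y j = 0) :
    SolMul (fun j => Multiset.replicate 1 (y j)) := by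
  refine ⟨ℂ, inferInstance, inferInstance, fun j => y j • 1, ?_, fun j => ?_⟩
  · rw [← Finset.sum_smul, hy, zero_smul]
  · exact ⟨Unit, inferInstance, Module.Basis.singleton Unit ℂ, fun _ => y j, by simp, by simp⟩

theorem sol_P (K : ℕ) : ∀ (x y z : Fin 3 → ℂ) (D : ℂ), D ≠ 0 →
    ∑ j, x j + ∑ j, y j + ∑ j, z j = D → ∑ j, z j = (K + 1) * D →
    (∀ j, ArmGen (K + 1) D (∑ j, x j) (y j - x j) (z j - x j)) →
    SolMul (fun j => Multiset.replicate (K + 1) (x j) +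
      (Multiset.replicate (K + 1) (y j) + Multiset.replicate K (z j))) := by
  induction K with
  | zero =>
    intro x y z D hD hs hz hg
    refine katz x _ (fun _ => 0) _ 2 1 (∑ j, x j) rfl ?_ ?_ ?_ ?_ ?_ ?_ ?_
    · simpa using (hg 0 0 (by omega)).1
    · simp
    · simp
    · simp
    · intro j w hw
      simp at hw
      subst hw
      simpa using (hg j 0 (by omega)).2.1
    · intro j w hw
      simp at hw
      subst hw
      have := (hg j 0 (by omega)).2.2.2.2.1
      intro e
      apply this
      push_cast
      linear_combination e
    · have := sol_single (fun j => y j + (∑ j, x j) / 3) (by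
        rw [Finset.sum_add_distrib]
        simp at hz ⊢
        linear_combination hs - hz)
      simpa using this
  | succ k ih =>
    intro x y z D hD hs hz hg
    set σ := ∑ j, x j with hσ
    push_cast at hz
    have hk1 : ((k : ℂ) + 1) ≠ 0 := by exact_mod_cast Nat.succ_ne_zero k
    refine katz x _ (fun _ => k + 1) _ (3 * k + 5) (3 * k + 4) σ hσ ?_ ?_ ?_ ?_ ?_ ?_ ?_
    · simpa using (hg 0 0 (by omega)).1
    · intro j; simp; omega
    · intro j; simp; omega
    · simp; omega
    · intro j w hw
      rcases mem_two hw with rfl | rfl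
      · simpa using (hg j 0 (by omega)).2.1
      · simpa using (hg j 0 (by omega)).2.2.1
    · intro j w hw
      rcases mem_two hw with rfl | rfl
      · intro e
        apply (hg j 0 (by omega)).2.2.2.2.1
        push_cast
        linear_combination e
      · intro e
        apply (hg j 0 (by omega)).2.2.2.2.2.1 (by omega)
        push_cast
        linear_combination e
    have step : SolMul (fun j => Multiset.replicate (k + 2) (y j + σ / 3) +
        (Multiset.replicate (k + 1) (z j + σ / 3) + Multiset.replicate (k + 1) (x j - 2 * σ / 3))) := by
      have hσ' : ∑ j, (y j + σ / 3) = -(k + 1) * D := by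
        rw [Finset.sum_add_distrib]
        simp
        linear_combination hs - hz
      refine katz (fun j => y j + σ / 3) _ (fun _ => k) _ (3 * k + 4) (3 * k + 2) (-(k + 1) * D)
        hσ'.symm ?_ ?_ ?_ ?_ ?_ ?_ ?_
      · exact mul_ne_zero (neg_ne_zero.2 hk1) hD
      · intro j; simp; omega
      · intro j; simp; omega
      · simp; omega
      · intro j w hw
        rcases mem_two hw with rfl | rfl
        · intro e
          apply (hg j 0 (by omega)).2.2.2.1
          push_cast
          linear_combination e
        · intro e
          apply (hg j 0 (by omega)).2.2.2.2.1
          push_cast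
          linear_combination -e
      · intro j w hw
        rcases mem_two hw with rfl | rfl
        · intro e
          apply (hg j (k + 1) (by omega)).2.2.2.1
          push_cast
          linear_combination e
        · intro e
          apply (hg j (k + 1) (by omega)).2.2.2.2.1
          push_cast
          linear_combination -e
      · have hx : ∑ j, (z j + σ / 3 + -(k + 1) * D / 3) = σ + D := by
          simp only [Finset.sum_add_distrib]
          simp
          linear_combination hz
        have := ih (fun j => z j + σ / 3 + -(k + 1) * D / 3)
          (fun j => x j - 2 * σ / 3 + -(k + 1) * D / 3)
          (fun j => y j + σ / 3 - 2 * (-(k + 1) * D) / 3) D hD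
          (by
            rw [hx]
            simp only [Finset.sum_add_distrib, Finset.sum_sub_distrib]
            simp [← hσ]
            linear_combination hs - hz)
          (by
            simp only [Finset.sum_add_distrib, Finset.sum_sub_distrib]
            simp
            linear_combination hs - hz)
          (by
            intro j
            rw [hx]
            convert (hg j).next using 1 <;> ring)
        convert this using 2
        simp only [Multiset.map_add, Multiset.map_replicate]
        abel
    convert step using 2
    simp only [Multiset.map_add, Multiset.map_replicate]
    abel

/-- Genericity in terms of multiplicities. -/
def CGen (K : ℕ) (x1 x2 x3 y1 y2 y3 z1 z2 z3 : ℂ) : Prop :=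
  ∀ a1 a2 a3 b1 b2 b3 c1 c2 c3 : ℕ,
    (a1 ≤ K + 1 ∧ a2 ≤ K + 1 ∧ a3 ≤ K + 1) ∧ (b1 ≤ K + 1 ∧ b2 ≤ K + 1 ∧ b3 ≤ K + 1) ∧
    (c1 ≤ K + 2 ∧ c2 ≤ K + 1 ∧ c3 ≤ K) ∧
    (a1 + a2 + a3 = b1 + b2 + b3 ∧ a1 + a2 + a3 = c1 + c2 + c3) ∧
    (1 ≤ a1 + a2 + a3 ∧ a1 + a2 + a3 ≤ 3 * K + 2) →
    (a1 * x1 + a2 * x2 + a3 * x3) + (b1 * y1 + b2 * y2 + b3 * y3) +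
      (c1 * z1 + c2 * z2 + c3 * z3) ≠ 0

theorem CGen.swap {K : ℕ} {x1 x2 x3 y1 y2 y3 z1 z2 z3 : ℂ}
    (G : CGen K x1 x2 x3 y1 y2 y3 z1 z2 z3) : CGen K y1 y2 y3 x1 x2 x3 z1 z2 z3 := by
  intro a1 a2 a3 b1 b2 b3 c1 c2 c3 h e
  exact G b1 b2 b3 a1 a2 a3 c1 c2 c3 (by omega) (by linear_combination e)

theorem armX {K : ℕ} {x1 x2 x3 y1 y2 y3 z1 z2 z3 D : ℂ}
    (G : CGen K x1 x2 x3 y1 y2 y3 z1 z2 z3) (hx : x3 ≠ x2) (hy : y2 ≠ y1)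
    (hD : D = x1 + x2 + x3 + (y1 + y2 + y3) + (z1 + z2 + z3))
    (ht : (K + 1) * D = z3 - z1) :
    ArmGen (K + 1) D (x2 + y2 + z1) (x3 - x2) (x1 - x2 - (x1 + y1 + z1)) := by
  intro m hm
  refine ⟨fun e => ?_, fun e => ?_, fun e => ?_, fun e => ?_, fun e => ?_, fun hm' e => ?_, fun e => ?_⟩
  · refine G m (m + 1) m m (m + 1) m (m + 1) m m (by omega) ?_
    subst hD
    push_cast; linear_combination e
  · rcases m with _ | m
    · apply hx
      push_cast at e; linear_combination e
    · refine G (m + 1) (m + 2) m (m + 1) (m + 1) (m + 1) (m + 1) (m + 1) (m + 1) (by omega) ?_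
      subst hD
      push_cast at e ⊢; linear_combination -e
  · refine G m (m + 1) m (m + 1) m m (m + 1) m m (by omega) ?_
    subst hD
    push_cast; linear_combination -e
  · refine G m m (m + 1) (m + 1) m m (m + 1) m m (by omega) ?_
    subst hD
    push_cast; linear_combination -e
  · refine G m m (m + 1) m (m + 1) m (m + 1) m m (by omega) ?_
    subst hD
    push_cast; linear_combination e
  · rcases m with _ | m
    · apply hy
      push_cast at e; linear_combination e
    · refine G (m + 1) (m + 1) (m + 1) m (m + 2) (m + 1) (m + 1) (m + 1) (m + 1) (by omega) ?_
      subst hD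
      push_cast at e ⊢; linear_combination e
  · rcases m with _ | m
    · refine G 1 0 0 0 0 1 0 1 0 (by omega) ?_
      push_cast at e ⊢; linear_combination e + ht - hD
    · refine G m (m + 1) (m + 1) (m + 1) (m + 1) m (m + 1) m (m + 1) (by omega) ?_
      push_cast at e ⊢; linear_combination -e - ht - m * hD

theorem armZ {K : ℕ} {x1 x2 x3 y1 y2 y3 z1 z2 z3 D : ℂ} (hK : 1 ≤ K)
    (G : CGen K x1 x2 x3 y1 y2 y3 z1 z2 z3) (hz : z3 ≠ z2)
    (hD : D = x1 + x2 + x3 + (y1 + y2 + y3) + (z1 + z2 + z3))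
    (ht : (K + 1) * D = z3 - z1) :
    ArmGen (K + 1) D (x2 + y2 + z1) (z2 - z1 + (x1 + y1 + z1)) (z3 - z1 + (x1 + y1 + z1)) := by
  intro m hm
  refine ⟨fun e => ?_, fun e => ?_, fun e => ?_, fun e => ?_, fun e => ?_, fun hm' e => ?_, fun e => ?_⟩
  · refine G m (m + 1) m m (m + 1) m (m + 1) m m (by omega) ?_
    subst hD
    push_cast; linear_combination e
  · rcases m with _ | m
    · refine G 1 0 0 1 0 0 0 1 0 (by omega) ?_
      push_cast at e ⊢; linear_combination e
    · refine G m (m + 1) (m + 1) m (m + 1) (m + 1) (m + 1) m (m + 1) (by omega) ?_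
      subst hD
      push_cast at e ⊢; linear_combination -e
  · rcases m with _ | m
    · refine G 1 0 0 1 0 0 0 0 1 (by omega) ?_
      push_cast at e ⊢; linear_combination e
    · refine G m (m + 1) (m + 1) m (m + 1) (m + 1) (m + 1) (m + 1) m (by omega) ?_
      subst hD
      push_cast at e ⊢; linear_combination -e
  · rcases m with _ | m
    · apply hz
      push_cast at e; linear_combination e
    · refine G (m + 1) (m + 1) (m + 1) (m + 1) (m + 1) (m + 1) (m + 1) (m + 2) m (by omega) ?_
      subst hD
      push_cast at e ⊢; linear_combination -e
  · refine G (m + 1) (m + 1) m (m + 1) (m + 1) m (m + 1) (m + 1) m (by omega) ?_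
    subst hD
    push_cast; linear_combination e
  · refine G (m + 1) (m + 1) m (m + 1) (m + 1) m (m + 1) m (m + 1) (by omega) ?_
    subst hD
    push_cast; linear_combination e
  · rcases m with _ | m
    · refine G 1 0 1 1 0 1 1 0 1 (by omega) ?_
      push_cast at e ⊢; linear_combination e + ht - hD
    · refine G m (m + 1) m m (m + 1) m m (m + 1) m (by omega) ?_
      push_cast at e ⊢; linear_combination -e - ht - m * hD

theorem sol_C {K : ℕ} {x1 x2 x3 y1 y2 y3 z1 z2 z3 : ℂ} (hK : 1 ≤ K)
    (G : CGen K x1 x2 x3 y1 y2 y3 z1 z2 z3)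
    (hx12 : x1 ≠ x2) (hx13 : x1 ≠ x3) (hx23 : x2 ≠ x3)
    (hy12 : y1 ≠ y2) (hy13 : y1 ≠ y3) (hy23 : y2 ≠ y3)
    (hz12 : z1 ≠ z2) (hz13 : z1 ≠ z3) (hz23 : z2 ≠ z3)
    (ht : (K + 1) * (x1 + x2 + x3 + (y1 + y2 + y3) + (z1 + z2 + z3)) = z3 - z1) :
    SolMul ![Multiset.replicate (K + 1) x1 + (Multiset.replicate (K + 1) x2 + Multiset.replicate (K + 1) x3),
      Multiset.replicate (K + 1) y1 + (Multiset.replicate (K + 1) y2 + Multiset.replicate (K + 1) y3),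
      Multiset.replicate (K + 2) z1 + (Multiset.replicate (K + 1) z2 + Multiset.replicate K z3)] := by
  obtain ⟨D, hD⟩ : ∃ D, D = x1 + x2 + x3 + (y1 + y2 + y3) + (z1 + z2 + z3) := ⟨_, rfl⟩
  rw [← hD] at ht
  obtain ⟨σ, hσ⟩ : ∃ σ, σ = x1 + y1 + z1 := ⟨_, rfl⟩
  have hD0 : D ≠ 0 := by
    have := G 1 1 1 1 1 1 1 1 1 (by omega)
    intro e
    apply this
    push_cast
    linear_combination e - hD
  have aX := armX G hx23.symm hy12.symm hD ht
  have aY := armX G.swap hy23.symm hx12.symm (by linear_combination hD) ht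
  have aZ := armZ hK G hz23.symm hD ht
  have hP := sol_P K ![x2 + σ / 3, y2 + σ / 3, z1 - 2 * σ / 3]
    ![x3 + σ / 3, y3 + σ / 3, z2 + σ / 3] ![x1 - 2 * σ / 3, y1 - 2 * σ / 3, z3 + σ / 3] D hD0
    (by simp [Fin.sum_univ_three]; rw [hD]; ring)
    (by simp [Fin.sum_univ_three]; linear_combination -ht - hσ)
    (by
      have hs : x2 + σ / 3 + (y2 + σ / 3) + (z1 - 2 * σ / 3) = x2 + y2 + z1 := by ring
      intro j
      fin_cases j
      · simp only [Fin.sum_univ_three]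
        simp only [Fin.isValue, Matrix.cons_val]
        rw [hs]
        convert aX using 1
        · simp
        · simp; linear_combination -hσ
      · simp only [Fin.sum_univ_three]
        simp only [Fin.isValue, Matrix.cons_val]
        rw [hs]
        convert aY using 1
        · ring
        · simp
        · simp; linear_combination -hσ
      · simp only [Fin.sum_univ_three]
        simp only [Fin.isValue, Matrix.cons_val]
        rw [hs]
        convert aZ using 1
        · simp; linear_combination hσ
        · simp; linear_combination hσ)
  have hK' := katz ![x1, y1, z1] ![K + 1, K + 1, K + 2] ![K, K, K + 1]
    ![Multiset.replicate (K + 1) x2 + Multiset.replicate (K + 1) x3,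
      Multiset.replicate (K + 1) y2 + Multiset.replicate (K + 1) y3,
      Multiset.replicate (K + 1) z2 + Multiset.replicate K z3] (3 * K + 3) (3 * K + 2) σ
    (by simp [Fin.sum_univ_three, hσ])
    (by
      have := G 1 0 0 1 0 0 1 0 0 (by omega)
      intro e
      apply this
      push_cast
      linear_combination e - hσ)
    (by intro j; fin_cases j <;> simp <;> omega)
    (by intro j; fin_cases j <;> simp <;> omega)
    (by simp [Fin.sum_univ_three]; omega)
    (by
      intro j w hw
      fin_cases j
      · rcases mem_two hw with rfl | rfl
        · exact sub_ne_zero.2 hx12.symm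
        · exact sub_ne_zero.2 hx13.symm
      · rcases mem_two hw with rfl | rfl
        · exact sub_ne_zero.2 hy12.symm
        · exact sub_ne_zero.2 hy13.symm
      · rcases mem_two hw with rfl | rfl
        · exact sub_ne_zero.2 hz12.symm
        · exact sub_ne_zero.2 hz13.symm)
    (by
      intro j w hw
      fin_cases j
      · rcases mem_two hw with rfl | rfl
        · intro e
          refine G 0 1 0 1 0 0 1 0 0 (by omega) ?_
          simp at e ⊢
          linear_combination e - hσ
        · intro e
          refine G 0 0 1 1 0 0 1 0 0 (by omega) ?_
          simp at e ⊢
          linear_combination e - hσ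
      · rcases mem_two hw with rfl | rfl
        · intro e
          refine G 1 0 0 0 1 0 1 0 0 (by omega) ?_
          simp at e ⊢
          linear_combination e - hσ
        · intro e
          refine G 1 0 0 0 0 1 1 0 0 (by omega) ?_
          simp at e ⊢
          linear_combination e - hσ
      · rcases mem_two hw with rfl | rfl
        · intro e
          refine G 1 0 0 1 0 0 0 1 0 (by omega) ?_
          simp at e ⊢
          linear_combination e - hσ
        · intro e
          refine G 1 0 0 1 0 0 0 0 1 (by omega) ?_
          simp at e ⊢
          linear_combination e - hσ)
    (by
      convert hP using 2 with j
      fin_cases j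
      · simp only [Fin.zero_eta, Fin.mk_one, Fin.reduceFinMk, Fin.isValue, Matrix.cons_val, Multiset.map_add, Multiset.map_replicate]
        abel
      · simp only [Fin.zero_eta, Fin.mk_one, Fin.reduceFinMk, Fin.isValue, Matrix.cons_val, Multiset.map_add, Multiset.map_replicate]
        abel
      · simp only [Fin.zero_eta, Fin.mk_one, Fin.reduceFinMk, Fin.isValue, Matrix.cons_val, Multiset.map_add, Multiset.map_replicate])
  convert hK' using 1
  ext1 j
  fin_cases j <;> rfl

theorem evCounts_three {n : ℕ} (d : Fin n → ℂ) (k1 k2 k3 : ℕ)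
    (h : evCounts d = ({k1, k2, k3} : Multiset ℕ)) :
    ∃ x1 x2 x3 : ℂ, x1 ≠ x2 ∧ x1 ≠ x3 ∧ x2 ≠ x3 ∧
      (Finset.univ : Finset (Fin n)).val.map d = Multiset.replicate k1 x1 +
        (Multiset.replicate k2 x2 + Multiset.replicate k3 x3) := by
  classical
  have h' : (Finset.univ.image d).val.map
      (fun σ => (Finset.univ.filter fun k => d k = σ).card) = k1 ::ₘ k2 ::ₘ k3 ::ₘ 0 := by
    unfold evCounts at h
    exact (by convert h using 2 : _ = ({k1, k2, k3} : Multiset ℕ))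
  obtain ⟨x1, m1, e1, h2⟩ := (Multiset.map_eq_cons _ _ _ _).2 h'
  obtain ⟨x2, m2, e2, h3⟩ := (Multiset.map_eq_cons _ _ _ _).2 h2
  obtain ⟨x3, m3, e3, h4⟩ := (Multiset.map_eq_cons _ _ _ _).2 h3
  rw [Multiset.map_eq_zero] at h4
  have hs : (Finset.univ.image d).val = x1 ::ₘ x2 ::ₘ x3 ::ₘ 0 := by
    rw [← Multiset.cons_erase m1, ← Multiset.cons_erase m2, ← Multiset.cons_erase m3, h4]
  have hnd := (Finset.univ.image d).nodup
  rw [hs] at hnd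
  simp at hnd
  refine ⟨x1, x2, x3, hnd.1.1, hnd.1.2, hnd.2, ?_⟩
  have hcount : ∀ y, Multiset.count y ((Finset.univ : Finset (Fin n)).val.map d) =
      (Finset.univ.filter fun k => d k = y).card := by
    intro y
    rw [Multiset.count_map]
    simp [Finset.card, Finset.filter, eq_comm]
  have himg : ((Finset.univ : Finset (Fin n)).val.map d).toFinset = Finset.univ.image d := rfl
  have hsum := Multiset.toFinset_sum_count_nsmul_eq ((Finset.univ : Finset (Fin n)).val.map d)
  rw [himg] at hsum
  rw [← hsum]
  simp only [hcount]
  unfold Finset.sum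
  rw [hs]
  simp only [Multiset.map_cons, Multiset.map_zero, Multiset.sum_cons, Multiset.sum_zero, e1, e2, e3,
    Multiset.nsmul_singleton, add_zero]

theorem quot_trace {n : ℕ} (A : Matrix (Fin n) (Fin n) ℂ) (d : Fin n → ℂ)
    (hA : MatConj (Matrix.diagonal d) A) (V : Submodule ℂ (Fin n → ℂ))
    (hV : V ≤ V.comap (Matrix.mulVecLin A)) :
    ∃ Φ : Finset (Fin n), Φ.card = Module.finrank ℂ ((Fin n → ℂ) ⧸ V) ∧
      LinearMap.trace ℂ _ (V.mapQ V (Matrix.mulVecLin A) hV) = ∑ i ∈ Φ, d i := by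
  classical
  obtain ⟨S, rfl⟩ := hA
  let w : Fin n → (Fin n → ℂ) := fun i => S.val *ᵥ Pi.single i 1
  have hw : ∀ i, (S.val * Matrix.diagonal d * (S⁻¹).val) *ᵥ w i = d i • w i := by
    intro i
    simp only [w]
    rw [Matrix.mulVec_mulVec, Matrix.mul_assoc, Units.inv_mul, Matrix.mul_one, ← Matrix.mulVec_mulVec,
      ← Matrix.mulVec_smul]
    congr 1
    ext r
    by_cases h : r = i
    · subst h; simp
    · simp [h]
  have hspan : Submodule.span ℂ (Set.range w) = ⊤ := by
    rw [eq_top_iff]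
    intro x _
    have hx : x = S.val *ᵥ ((S⁻¹).val *ᵥ x) := by
      rw [Matrix.mulVec_mulVec, Units.mul_inv, Matrix.one_mulVec]
    rw [hx]
    generalize (S⁻¹).val *ᵥ x = u
    have : S.val *ᵥ u = ∑ i, u i • w i := by
      simp only [w, ← Matrix.mulVec_smul]
      rw [← Matrix.mulVec_sum]
      congr 1
      ext r
      simp [Finset.sum_apply, Pi.single_apply]
    rw [this]
    exact Submodule.sum_mem _ fun i _ => Submodule.smul_mem _ _ (Submodule.subset_span ⟨i, rfl⟩)
  obtain ⟨κ, a, ha, hsp, hli⟩ := exists_linearIndependent' ℂ (fun i => V.mkQ (w i))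
  have hfk : Finite κ := Finite.of_injective a ha
  have := Fintype.ofFinite κ
  have hsp' : Submodule.span ℂ (Set.range ((fun i => V.mkQ (w i)) ∘ a)) = ⊤ := by
    rw [hsp, show (fun i => V.mkQ (w i)) = V.mkQ ∘ w from rfl, Set.range_comp, Submodule.span_image,
      hspan, Submodule.map_top, Submodule.range_mkQ]
  let b := Module.Basis.mk hli hsp'.ge
  have hb : ∀ i, b i = V.mkQ (w (a i)) := fun i => by simp [b]
  refine ⟨Finset.univ.map ⟨a, ha⟩, ?_, ?_⟩
  · rw [Finset.card_map, Module.finrank_eq_card_basis b]; rfl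
  · rw [LinearMap.trace_eq_matrix_trace ℂ b, Finset.sum_map, Matrix.trace]
    apply Finset.sum_congr rfl
    intro i _
    rw [Matrix.diag_apply, LinearMap.toMatrix_apply]
    have : (V.mapQ V (Matrix.mulVecLin (S.val * Matrix.diagonal d * (S⁻¹).val)) hV) (b i) =
        d (a i) • b i := by
      rw [hb, Submodule.mkQ_apply, Submodule.mapQ_apply, Matrix.mulVecLin_apply, hw]
      rfl
    rw [this]
    simp

theorem irred_of_generic {n : ℕ} (d : Fin 3 → Fin n → ℂ) (hgen : GenericAddEV d)
    (A : Fin 3 → Matrix (Fin n) (Fin n) ℂ) (hA : ∑ j, A j = 0)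
    (hc : ∀ j, MatConj (Matrix.diagonal (d j)) (A j)) : IrreducibleTuple A := by
  intro V hV
  by_contra hne
  push Not at hne
  have hV' : ∀ j, V ≤ V.comap (Matrix.mulVecLin (A j)) := fun j => Submodule.map_le_iff_le_comap.1 (hV j)
  choose Φ hΦ hT using fun j => quot_trace (A j) (d j) (hc j) V (hV' j)
  have hdim := Submodule.finrank_quotient_add_finrank V
  have h1 : 0 < Module.finrank ℂ V := by
    rw [Nat.pos_iff_ne_zero]
    intro h
    exact hne.1 (Submodule.finrank_eq_zero.1 h)
  have h2 : Module.finrank ℂ V < Module.finrank ℂ (Fin n → ℂ) :=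
    Submodule.finrank_lt hne.2
  rw [Module.finrank_fin_fun] at hdim h2
  refine hgen (Module.finrank ℂ ((Fin n → ℂ) ⧸ V)) (by omega) (by omega) Φ hΦ ?_
  rw [← Finset.sum_congr rfl (fun j _ => hT j), ← map_sum]
  have : ∑ j, V.mapQ V (Matrix.mulVecLin (A j)) (hV' j) = 0 := by
    apply Submodule.linearMap_qext
    refine LinearMap.ext fun x => ?_
    simp only [LinearMap.comp_apply, LinearMap.sum_apply, Submodule.mkQ_apply, Submodule.mapQ_apply,
      Matrix.mulVecLin_apply]
    have e : ∑ j, (A j) *ᵥ x = 0 := by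
      rw [← Matrix.sum_mulVec, hA, Matrix.zero_mulVec]
    have := congrArg V.mkQ e
    rw [map_sum] at this
    simpa using this
  rw [this, map_zero]

theorem exists_of_sol {n : ℕ} (d : Fin 3 → Fin n → ℂ)
    (h : SolMul (fun j => (Finset.univ : Finset (Fin n)).val.map (d j))) :
    ∃ A : Fin 3 → Matrix (Fin n) (Fin n) ℂ,
      (∑ j, A j) = 0 ∧ ∀ j, MatConj (Matrix.diagonal (d j)) (A j) := by
  classical
  obtain ⟨V, _, _, T, hT, hE⟩ := h
  have hE' : ∀ j, ∃ b : Module.Basis (Fin n) ℂ V, ∀ i, T j (b i) = d j i • b i := by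
    intro j
    obtain ⟨ι, _, b, v, hv, hb⟩ := hE j
    obtain ⟨e, he⟩ := equiv_of_map_eq v (d j) hv
    refine ⟨b.reindex e, fun i => ?_⟩
    rw [Module.Basis.reindex_apply, hb, ← he, Equiv.apply_symm_apply]
  choose b hb using hE'
  refine ⟨fun j => LinearMap.toMatrix (b 0) (b 0) (T j), ?_, fun j => ?_⟩
  · rw [← map_sum, hT, map_zero]
  · refine ⟨⟨(b 0).toMatrix (b j), (b j).toMatrix (b 0), ?_, ?_⟩, ?_⟩
    · exact Module.Basis.toMatrix_mul_toMatrix_flip _ _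
    · exact Module.Basis.toMatrix_mul_toMatrix_flip _ _
    · have : Matrix.diagonal (d j) = LinearMap.toMatrix (b j) (b j) (T j) := by
        ext r c
        rw [LinearMap.toMatrix_apply, hb]
        by_cases h : r = c
        · subst h; simp
        · simp [h]
      rw [this]
      exact (basis_toMatrix_mul_linearMap_toMatrix_mul_basis_toMatrix (b 0) (b j) (b 0) (b j) (T j)).symm

/-- existence of the rigid series `C_k`, `n = 3k`, PMV
`(k,k,k), (k,k,k), (k+1,k,k-1)`. -/
theorem stmt9 (k : ℕ) (hk : 2 ≤ k) (n : ℕ) (hn : n = 3 * k)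
    (d : Fin 3 → Fin n → ℂ)
    (hmv0 : evCounts (d 0) = ({k, k, k} : Multiset ℕ))
    (hmv1 : evCounts (d 1) = ({k, k, k} : Multiset ℕ))
    (hmv2 : evCounts (d 2) = ({k + 1, k, k - 1} : Multiset ℕ))
    (hsum : (∑ j, ∑ i, d j i) = 0)
    (hgen : GenericAddEV d) :
    ∃ A : Fin 3 → Matrix (Fin n) (Fin n) ℂ,
      (∑ j, A j) = 0 ∧ IrreducibleTuple A ∧
      ∀ j, MatConj (Matrix.diagonal (d j)) (A j) := by
  obtain ⟨K, rfl⟩ : ∃ K, k = K + 1 := ⟨k - 1, by omega⟩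
  subst hn
  obtain ⟨x1, x2, x3, hx12, hx13, hx23, hx⟩ := evCounts_three _ _ _ _ hmv0
  obtain ⟨y1, y2, y3, hy12, hy13, hy23, hy⟩ := evCounts_three _ _ _ _ hmv1
  obtain ⟨z1, z2, z3, hz12, hz13, hz23, hz⟩ := evCounts_three _ _ _ _ hmv2
  simp only [Nat.add_sub_cancel] at hz
  have G : CGen K x1 x2 x3 y1 y2 y3 z1 z2 z3 := by
    intro a1 a2 a3 b1 b2 b3 c1 c2 c3 h
    have hle : ∀ {p1 p2 p3 q1 q2 q3 : ℕ} (u1 u2 u3 : ℂ), p1 ≤ q1 → p2 ≤ q2 → p3 ≤ q3 →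
        Multiset.replicate p1 u1 + (Multiset.replicate p2 u2 + Multiset.replicate p3 u3) ≤
        Multiset.replicate q1 u1 + (Multiset.replicate q2 u2 + Multiset.replicate q3 u3) := by
      intro p1 p2 p3 q1 q2 q3 u1 u2 u3 h1 h2 h3
      exact add_le_add (Multiset.replicate_mono _ h1)
        (add_le_add (Multiset.replicate_mono _ h2) (Multiset.replicate_mono _ h3))
    obtain ⟨Φ0, hc0, hs0⟩ := exists_finset_of_le_map (d 0)
      (Multiset.replicate a1 x1 + (Multiset.replicate a2 x2 + Multiset.replicate a3 x3))
      (by rw [hx]; exact hle _ _ _ (by omega) (by omega) (by omega))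
    obtain ⟨Φ1, hc1, hs1⟩ := exists_finset_of_le_map (d 1)
      (Multiset.replicate b1 y1 + (Multiset.replicate b2 y2 + Multiset.replicate b3 y3))
      (by rw [hy]; exact hle _ _ _ (by omega) (by omega) (by omega))
    obtain ⟨Φ2, hc2, hs2⟩ := exists_finset_of_le_map (d 2)
      (Multiset.replicate c1 z1 + (Multiset.replicate c2 z2 + Multiset.replicate c3 z3))
      (by rw [hz]; exact hle _ _ _ (by omega) (by omega) (by omega))
    simp at hc0 hc1 hc2 hs0 hs1 hs2
    have := hgen (a1 + a2 + a3) (by omega) (by omega) ![Φ0, Φ1, Φ2] (by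
      intro j
      fin_cases j <;> simp <;> omega)
    rw [Fin.sum_univ_three] at this
    simp only [Fin.isValue, Matrix.cons_val] at this
    rw [hs0, hs1, hs2] at this
    intro e
    apply this
    linear_combination e
  have ht : ((K : ℂ) + 1) * (x1 + x2 + x3 + (y1 + y2 + y3) + (z1 + z2 + z3)) = z3 - z1 := by
    have e0 := congrArg Multiset.sum hx
    have e1 := congrArg Multiset.sum hy
    have e2 := congrArg Multiset.sum hz
    rw [Fin.sum_univ_three] at hsum
    change ∑ i, d 0 i = _ at e0
    change ∑ i, d 1 i = _ at e1
    change ∑ i, d 2 i = _ at e2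
    simp only [Multiset.sum_add, Multiset.sum_replicate, nsmul_eq_mul] at e0 e1 e2
    push_cast at e0 e1 e2
    rw [e0, e1, e2] at hsum
    linear_combination hsum
  have hS := sol_C (by omega) G hx12 hx13 hx23 hy12 hy13 hy23 hz12 hz13 hz23 ht
  have hS' : SolMul (fun j => (Finset.univ : Finset (Fin (3 * (K + 1)))).val.map (d j)) := by
    convert hS using 1
    ext1 j
    fin_cases j
    · exact hx
    · exact hy
    · exact hz
  obtain ⟨A, hA, hc⟩ := exists_of_sol d hS'
  exact ⟨A, hA, irred_of_generic d hgen A hA hc, hc⟩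
end

section
/- Let k ≥ 1 and n = 2k + 1. For every choice of generic eigenvalues compatible with the quadruple of multiplicity vectors S_k : Λ₁ = Λ₂ = Λ₃ = Λ₄ = (k+1, k), there exists an irreducible quadruple of diagonalizable matrices A₁, A₂, A₃, A₄ ∈ gl(n,ℂ) with A₁ + A₂ + A₃ + A₄ = 0, where each A_j has two distinct eigenvalues with multiplicities k+1 and k equal to the chosen generic eigenvalues. (This quadruple of multiplicity vectors is rigid: d₁ + d₂ + d₃ + d₄ = 2n² − 2.) -/
open Matrix BigOperators

lemma aux_counts {k n : ℕ} (d : Fin n → ℂ) (h : evCounts d = ({k + 1, k} : Multiset ℕ)) :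
    ∃ a b : ℂ, a ≠ b ∧ (∀ i, d i = a ∨ d i = b) ∧
      (Finset.univ.filter fun i => d i = a).card = k + 1 ∧
      (Finset.univ.filter fun i => d i = b).card = k := by
  classical
  unfold evCounts at h
  have hc := congrArg Multiset.card h
  simp only [Multiset.card_map, Finset.card_val, Multiset.insert_eq_cons, Multiset.card_cons,
    Multiset.card_singleton] at hc
  obtain ⟨x, y, hxy, himg⟩ := Finset.card_eq_two.1 hc
  have hval : (Finset.univ.image d).val = x ::ₘ {y} := by
    rw [himg, Finset.insert_val_of_notMem (by simpa using hxy)]; rfl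
  have hm : ∀ i, d i = x ∨ d i = y := by
    intro i
    have : d i ∈ Finset.univ.image d := Finset.mem_image_of_mem _ (Finset.mem_univ _)
    rw [himg] at this
    simpa using this
  rw [hval] at h
  simp only [Multiset.map_cons, Multiset.map_singleton, Multiset.insert_eq_cons] at h
  have h2 := Multiset.cons_eq_cons.1 h
  rcases h2 with ⟨h1, h2⟩ | ⟨-, cs, h1, h2⟩
  · refine ⟨x, y, hxy, hm, ?_, ?_⟩
    · convert h1
    · convert Multiset.singleton_inj.1 h2
  · have hcs : cs = 0 := by
      have := congrArg Multiset.card h1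
      simpa using this
    subst hcs
    simp at h1 h2
    refine ⟨y, x, hxy.symm, fun i => (hm i).symm, ?_, ?_⟩
    · convert h1
    · convert h2.symm

/-- Genericity in terms of dimension vectors. -/
lemma aux_generic {k n : ℕ} (hn : n = 2 * k + 1) (d : Fin 4 → Fin n → ℂ)
    (hgen : GenericAddEV d) (a b : Fin 4 → ℂ) (hab : ∀ j, a j ≠ b j)
    (ha : ∀ j, (Finset.univ.filter fun i => d j i = a j).card = k + 1)
    (hb : ∀ j, (Finset.univ.filter fun i => d j i = b j).card = k)
    (κ : ℕ) (h1 : 1 ≤ κ) (h2 : κ ≤ 2 * k) (t : Fin 4 → ℕ) (ht1 : ∀ j, t j ≤ k)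
    (ht2 : ∀ j, t j ≤ κ) (ht3 : ∀ j, κ ≤ t j + (k + 1)) :
    ∑ j, ((κ : ℂ) * a j + t j * (b j - a j)) ≠ 0 := by
  classical
  have H : ∀ j, ∃ Φ : Finset (Fin n), Φ.card = κ ∧
      ∑ i ∈ Φ, d j i = (κ : ℂ) * a j + t j * (b j - a j) := by
    intro j
    obtain ⟨B, hB, hBc⟩ := Finset.exists_subset_card_eq (s := Finset.univ.filter fun i => d j i = b j)
      (n := t j) (by rw [hb]; exact ht1 j)
    obtain ⟨A, hA, hAc⟩ := Finset.exists_subset_card_eq (s := Finset.univ.filter fun i => d j i = a j)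
      (n := κ - t j) (by rw [ha]; have := ht3 j; omega)
    have hd : Disjoint A B := by
      rw [Finset.disjoint_left]
      intro i hi hi'
      have h1 := hA hi
      have h2 := hB hi'
      simp at h1 h2
      exact hab j (h1.symm.trans h2)
    refine ⟨A ∪ B, ?_, ?_⟩
    · rw [Finset.card_union_of_disjoint hd, hAc, hBc]; have := ht2 j; omega
    · rw [Finset.sum_union hd, Finset.sum_congr rfl (g := fun _ => a j),
        Finset.sum_congr (s₁ := B) rfl (g := fun _ => b j)]
      · simp only [Finset.sum_const, hAc, hBc, nsmul_eq_mul]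
        rw [Nat.cast_sub (ht2 j)]; ring
      · intro i hi; have := hB hi; simpa using this
      · intro i hi; have := hA hi; simpa using this
  choose Φ hΦ1 hΦ2 using H
  have := hgen κ h1 (by omega) Φ hΦ1
  simpa only [hΦ2] using this

/-- A pair of idempotents with prescribed (diagonal) linear combination. -/
lemma aux_pair {k n : ℕ} (e : (Fin k ⊕ Fin k) ⊕ Unit ≃ Fin n) (m : Fin n → ℂ) (c₁ c₂ : ℂ)
    (hc₁ : c₁ ≠ 0) (hc₂ : c₂ ≠ 0)
    (hsum : ∀ i, m (e (Sum.inl (Sum.inl i))) + m (e (Sum.inl (Sum.inr i))) = c₁ + c₂)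
    (hne : ∀ i, m (e (Sum.inl (Sum.inl i))) ≠ m (e (Sum.inl (Sum.inr i))))
    (h0 : m (e (Sum.inr ())) = 0) :
    ∃ P Q : Matrix (Fin n) (Fin n) ℂ, P * P = P ∧ Q * Q = Q ∧ P.trace = k ∧ Q.trace = k ∧
      c₁ • P + c₂ • Q = diagonal m := by
  classical
  set x : Fin k → ℂ := fun i => m (e (Sum.inl (Sum.inl i))) with hx
  set y : Fin k → ℂ := fun i => m (e (Sum.inl (Sum.inr i))) with hy
  have hxy : ∀ i, x i - y i ≠ 0 := fun i => sub_ne_zero.2 (hne i)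
  have hs : ∀ i, y i = c₁ + c₂ - x i := fun i => by rw [← hsum i]; simp [x, y]
  let p : Fin k → ℂ := fun i => x i * (c₁ - y i) / (c₁ * (x i - y i))
  let P₀ : Matrix ((Fin k ⊕ Fin k) ⊕ Unit) ((Fin k ⊕ Fin k) ⊕ Unit) ℂ :=
    fromBlocks (fromBlocks (diagonal p) (diagonal p) (diagonal fun i => 1 - p i)
      (diagonal fun i => 1 - p i)) 0 0 0
  let Q₀ : Matrix ((Fin k ⊕ Fin k) ⊕ Unit) ((Fin k ⊕ Fin k) ⊕ Unit) ℂ :=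
    fromBlocks (fromBlocks (diagonal fun i => (x i - c₁ * p i) / c₂)
      (diagonal fun i => - c₁ * p i / c₂) (diagonal fun i => - c₁ * (1 - p i) / c₂)
      (diagonal fun i => (y i - c₁ * (1 - p i)) / c₂)) 0 0 0
  have hP : P₀ * P₀ = P₀ := by
    simp only [P₀, fromBlocks_multiply, diagonal_mul_diagonal, diagonal_add, Matrix.mul_zero, Matrix.zero_mul,
      add_zero]
    congr 2 <;> (congr 1; funext i; ring)
  have hQ : Q₀ * Q₀ = Q₀ := by
    simp only [Q₀, fromBlocks_multiply, diagonal_mul_diagonal, diagonal_add, Matrix.mul_zero, Matrix.zero_mul,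
      add_zero]
    have hp : ∀ i, p i * (c₁ * (x i - y i)) = x i * (c₁ - y i) := fun i =>
      div_mul_cancel₀ _ (mul_ne_zero hc₁ (hxy i))
    congr 2 <;>
    · congr 1; funext i
      have h1 := hp i
      simp only [hs i] at h1 ⊢
      field_simp
      first
        | ring1
        | linear_combination h1
        | linear_combination -h1
        | linear_combination c₁ * h1
        | linear_combination -c₁ * h1
  have hPt : P₀.trace = k := by
    simp [P₀, Matrix.trace, Finset.sum_sub_distrib]
  have hQt : Q₀.trace = k := by
    simp only [Q₀, Matrix.trace, Fintype.sum_sum_type, diag_apply, fromBlocks_apply₁₁,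
      fromBlocks_apply₂₂, diagonal_apply_eq, Matrix.zero_apply, Finset.sum_const_zero, add_zero]
    rw [← Finset.sum_add_distrib, Finset.sum_congr rfl (g := fun _ => (1 : ℂ))]
    · simp
    · intro i _
      rw [hs i]; field_simp; ring
  have hPQ : c₁ • P₀ + c₂ • Q₀ = diagonal (m ∘ e) := by
    have : m ∘ e = Sum.elim (Sum.elim x y) (fun _ => 0) := by
      funext i
      rcases i with (i | i) | i
      · rfl
      · rfl
      · exact h0
    rw [this]
    have h0' : (0 : Matrix Unit Unit ℂ) = diagonal (fun _ => 0) := by simp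
    rw [← fromBlocks_diagonal, ← fromBlocks_diagonal]
    simp only [P₀, Q₀, fromBlocks_smul, fromBlocks_add, ← diagonal_smul, diagonal_add, smul_zero,
      add_zero, ← h0']
    congr 2
    · congr 1; funext i; simp; field_simp; ring
    · rw [← diagonal_zero]; congr 1; funext i; simp; field_simp; ring
    · rw [← diagonal_zero]; congr 1; funext i; simp; field_simp; ring
    · congr 1; funext i; simp; field_simp; ring
  refine ⟨reindex e e P₀, reindex e e Q₀, ?_, ?_, ?_, ?_, ?_⟩
  · simp only [reindex_apply, submatrix_mul_equiv, hP]
  · simp only [reindex_apply, submatrix_mul_equiv, hQ]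
  · rw [← hPt]
    exact e.symm.sum_comp (fun i => P₀ i i)
  · rw [← hQt]
    exact e.symm.sum_comp (fun i => Q₀ i i)
  · have := congrArg (reindex e e) hPQ
    simp only [reindex_apply, submatrix_add, submatrix_smul, submatrix_diagonal_equiv] at this ⊢
    simpa [Function.comp_assoc] using this

/-- An idempotent of the right trace is conjugate to the diagonal one. -/
lemma aux_conj {k n : ℕ} (d : Fin n → ℂ) (a b : ℂ)
    (hd : ∀ i, d i = a ∨ d i = b) (hab : a ≠ b)
    (hb : (Finset.univ.filter fun i => d i = b).card = k)
    (P : Matrix (Fin n) (Fin n) ℂ) (hP : P * P = P) (ht : P.trace = k) :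
    MatConj (diagonal d) (a • (1 : Matrix (Fin n) (Fin n) ℂ) + (b - a) • P) := by
  classical
  set f : (Fin n → ℂ) →ₗ[ℂ] (Fin n → ℂ) := Matrix.toLin' P with hf
  have hff : IsIdempotentElem f := by
    unfold IsIdempotentElem
    rw [hf, Module.End.mul_eq_comp, ← Matrix.toLin'_mul, hP]
  have hcompl : IsCompl (LinearMap.range f) (LinearMap.ker f) :=
    LinearMap.IsIdempotentElem.isCompl hff
  have hproj : LinearMap.IsProj (LinearMap.range f) f := LinearMap.IsIdempotentElem.isProj_range f hff
  have htr : (Module.finrank ℂ (LinearMap.range f) : ℂ) = k := by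
    rw [← hproj.trace, hf, Matrix.trace_toLin'_eq, ht]
  have hr : Module.finrank ℂ (LinearMap.range f) = k := by exact_mod_cast htr
  have hrk := LinearMap.finrank_range_add_finrank_ker f
  have hcb : Fintype.card {i // d i = b} = k := by
    rw [Fintype.card_subtype]; convert hb
  have hcn : Fintype.card {i // ¬ d i = b} = n - k := by
    rw [Fintype.card_subtype_compl, hcb]; simp
  let b1 : Module.Basis {i // d i = b} ℂ (LinearMap.range f) :=
    (Module.finBasisOfFinrankEq ℂ _ hr).reindex (Fintype.equivOfCardEq (by simp [hcb]))
  have hk : Module.finrank ℂ (LinearMap.ker f) = n - k := by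
    simp at hrk; omega
  let b2 : Module.Basis {i // ¬ d i = b} ℂ (LinearMap.ker f) :=
    (Module.finBasisOfFinrankEq ℂ _ hk).reindex (Fintype.equivOfCardEq (by simp [hcn]))
  let B : Module.Basis (Fin n) ℂ (Fin n → ℂ) :=
    ((b1.prod b2).map (Submodule.prodEquivOfIsCompl _ _ hcompl)).reindex
      (Equiv.sumCompl fun i => d i = b)
  have hB1 : ∀ i, d i = b → f (B i) = B i := by
    intro i hi
    have : B i = b1 ⟨i, hi⟩ := by
      simp [B, Module.Basis.reindex_apply, Equiv.sumCompl_symm_apply_of_pos, hi]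
    rw [this]
    exact hproj.map_id _ (b1 ⟨i, hi⟩).2
  have hB2 : ∀ i, ¬ d i = b → f (B i) = 0 := by
    intro i hi
    have : B i = b2 ⟨i, hi⟩ := by
      simp [B, Module.Basis.reindex_apply, Equiv.sumCompl_symm_apply_of_neg, hi]
    rw [this]
    exact (b2 ⟨i, hi⟩).2
  let S : Matrix (Fin n) (Fin n) ℂ := (Pi.basisFun ℂ (Fin n)).toMatrix B
  let T : Matrix (Fin n) (Fin n) ℂ := B.toMatrix (Pi.basisFun ℂ (Fin n))
  have hST : S * T = 1 := Module.Basis.toMatrix_mul_toMatrix_flip _ _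
  have hTS : T * S = 1 := Module.Basis.toMatrix_mul_toMatrix_flip _ _
  refine ⟨⟨S, T, hST, hTS⟩, ?_⟩
  have key : (a • (1 : Matrix (Fin n) (Fin n) ℂ) + (b - a) • P) * S = S * diagonal d := by
    ext i j
    have hSj : ∀ i, S i j = B j i := fun i => by
      simp [S, Module.Basis.toMatrix_apply]
    have hPS : (P * S) i j = f (B j) i := by
      simp [hf, Matrix.mul_apply, Matrix.mulVec, dotProduct, hSj]
    rw [mul_diagonal, add_mul, smul_mul_assoc, smul_mul_assoc, one_mul, Matrix.add_apply,
      Matrix.smul_apply, Matrix.smul_apply, hPS, hSj]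
    by_cases hj : d j = b
    · rw [hB1 j hj, hj]; simp; ring
    · rw [hB2 j hj, (hd j).resolve_right hj]; simp; ring
  change _ = S * diagonal d * T
  rw [← key, mul_assoc, hST, mul_one]

lemma aux_trace {W : Type*} [AddCommGroup W] [Module ℂ W] [FiniteDimensional ℂ W]
    (g : W →ₗ[ℂ] W) (hg : IsIdempotentElem g) :
    LinearMap.trace ℂ W g = (Module.finrank ℂ (LinearMap.range g) : ℂ) :=
  (LinearMap.IsIdempotentElem.isProj_range g hg).trace

/-- trace data of a restriction of an idempotent. -/
lemma aux_restrict {k n : ℕ} (hn : n = 2 * k + 1)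
    (P : Matrix (Fin n) (Fin n) ℂ) (hP : P * P = P) (ht : P.trace = k)
    (V : Submodule ℂ (Fin n → ℂ)) (hV : ∀ v ∈ V, Matrix.toLin' P v ∈ V) :
    ∃ t : ℕ, t ≤ k ∧ t ≤ Module.finrank ℂ V ∧ Module.finrank ℂ V ≤ t + (k + 1) ∧
      LinearMap.trace ℂ V ((Matrix.toLin' P).restrict hV) = t := by
  classical
  set f : (Fin n → ℂ) →ₗ[ℂ] (Fin n → ℂ) := Matrix.toLin' P with hf
  have hff : IsIdempotentElem f := by
    unfold IsIdempotentElem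
    rw [hf, Module.End.mul_eq_comp, ← Matrix.toLin'_mul, hP]
  have hfv : ∀ v, f (f v) = f v := fun v => by
    have := LinearMap.congr_fun hff v
    simpa using this
  have hproj : LinearMap.IsProj (LinearMap.range f) f := LinearMap.IsIdempotentElem.isProj_range f hff
  have htr : (Module.finrank ℂ (LinearMap.range f) : ℂ) = k := by
    rw [← hproj.trace, hf, Matrix.trace_toLin'_eq, ht]
  have hr : Module.finrank ℂ (LinearMap.range f) = k := by exact_mod_cast htr
  have hrk := LinearMap.finrank_range_add_finrank_ker f
  have hk : Module.finrank ℂ (LinearMap.ker f) = k + 1 := by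
    simp at hrk; omega
  set g := f.restrict hV with hg
  have hgg : IsIdempotentElem g := by
    ext v : 2
    simp [hg, hfv]
  have hgrk := LinearMap.finrank_range_add_finrank_ker g
  have h1 : Module.finrank ℂ (LinearMap.range g) ≤ k := by
    rw [← hr, ← Submodule.finrank_map_subtype_eq]
    apply Submodule.finrank_mono
    rintro _ ⟨_, ⟨v, rfl⟩, rfl⟩
    exact ⟨v, rfl⟩
  have h2 : Module.finrank ℂ (LinearMap.ker g) ≤ k + 1 := by
    rw [← hk, ← Submodule.finrank_map_subtype_eq]
    apply Submodule.finrank_mono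
    rintro _ ⟨v, hv, rfl⟩
    exact congrArg Subtype.val (LinearMap.mem_ker.1 hv)
  exact ⟨Module.finrank ℂ (LinearMap.range g), h1, by omega, by omega, aux_trace g hgg⟩

/-- existence of the rigid series `S_k`, `n = 2k+1`, PMV
`(k+1,k), (k+1,k), (k+1,k), (k+1,k)`. -/
theorem stmt10 (k : ℕ) (hk : 1 ≤ k) (n : ℕ) (hn : n = 2 * k + 1)
    (d : Fin 4 → Fin n → ℂ)
    (hmv : ∀ j, evCounts (d j) = ({k + 1, k} : Multiset ℕ))
    (hsum : (∑ j, ∑ i, d j i) = 0)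
    (hgen : GenericAddEV d) :
    ∃ A : Fin 4 → Matrix (Fin n) (Fin n) ℂ,
      (∑ j, A j) = 0 ∧ IrreducibleTuple A ∧
      ∀ j, MatConj (Matrix.diagonal (d j)) (A j) := by
  classical
  choose a b hab hd ha hb using fun j => aux_counts (d j) (hmv j)
  have G := aux_generic hn d hgen a b hab ha hb
  have hc : ∀ j, b j - a j ≠ 0 := fun j => sub_ne_zero.2 (hab j).symm
  have hkC : (k : ℂ) ≠ 0 := by exact_mod_cast (by omega : k ≠ 0)
  -- the trace relation
  have htrace : ∑ j, ((2 * k + 1 : ℂ) * a j + k * (b j - a j)) = 0 := by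
    rw [← hsum]
    refine Finset.sum_congr rfl fun j _ => ?_
    have h1 : ∀ i, d j i = (if d j i = a j then a j else 0) + (if d j i = b j then b j else 0) := by
      intro i
      rcases hd j i with h | h
      · simp [h, hab j]
      · simp [h, (hab j).symm]
    rw [Finset.sum_congr rfl fun i _ => h1 i, Finset.sum_add_distrib, ← Finset.sum_filter,
      ← Finset.sum_filter, Finset.sum_const, Finset.sum_const, ha, hb]
    simp; ring
  simp only [Fin.sum_univ_four] at htrace
  set s : ℂ := -(a 0 + a 1 + a 2 + a 3) with hs
  set δ : ℂ := s / k with hδ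
  have hsδ : s = k * δ := by rw [hδ]; field_simp
  set c₁₂ : ℂ := (b 0 - a 0) + (b 1 - a 1) with hc₁₂
  set c₃₄ : ℂ := (b 2 - a 2) + (b 3 - a 3) with hc₃₄
  have hrel : c₁₂ + c₃₄ = (2 * k + 1) * δ := by
    have : (k : ℂ) * (c₁₂ + c₃₄) = k * ((2 * k + 1) * δ) := by
      linear_combination htrace + (2 * k + 1) * (hs - hsδ) - (2 * k + 1) * (hs - hsδ) + (2*k+1) * hsδ - (2*k+1) * hs
    exact mul_left_cancel₀ hkC this
  have hne : ∀ m : ℕ, 1 ≤ m → m ≤ 2 * k → c₁₂ ≠ m * δ := by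
    intro m hm1 hm2 hcm
    have hc34 : c₃₄ = (2 * k + 1 - m) * δ := by linear_combination hrel - hcm
    by_cases hmk : m ≤ k
    · have := G (2 * k + 1 - 2 * m) (by omega) (by omega)
        ![k + 1 - m, k + 1 - m, k - m, k - m]
        (by intro j; fin_cases j <;> simp <;> omega)
        (by intro j; fin_cases j <;> simp <;> omega)
        (by intro j; fin_cases j <;> simp <;> omega)
      apply this
      simp [Fin.sum_univ_four]
      rw [Nat.cast_sub (by omega), Nat.cast_sub (by omega), Nat.cast_sub (by omega)]
      push_cast
      linear_combination (k + 1 - m : ℂ) * hcm + (k - m : ℂ) * hc34 - (2 * k + 1 - 2 * m : ℂ) * (hsδ - hs)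
    · have := G (2 * m - 2 * k - 1) (by omega) (by omega)
        ![m - k - 1, m - k - 1, m - k, m - k]
        (by intro j; fin_cases j <;> simp <;> omega)
        (by intro j; fin_cases j <;> simp <;> omega)
        (by intro j; fin_cases j <;> simp <;> omega)
      apply this
      simp [Fin.sum_univ_four]
      rw [Nat.sub_sub, Nat.sub_sub, Nat.cast_sub (by omega), Nat.cast_sub (by omega),
        Nat.cast_sub (by omega)]
      push_cast
      linear_combination -(k + 1 - m : ℂ) * hcm - (k - m : ℂ) * hc34 + (2 * k + 1 - 2 * m : ℂ) * (hsδ - hs)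
  -- index bookkeeping
  let g : Fin (k + 1) ⊕ Fin k ≃ Fin n := Fintype.equivOfCardEq (by simp; omega)
  let m₀ : Fin (k + 1) ⊕ Fin k → ℂ :=
    Sum.elim (fun j => (j : ℕ) * δ) (fun j => c₁₂ - ((j : ℕ) + 1) * δ)
  let e1f : (Fin k ⊕ Fin k) ⊕ Unit → Fin (k + 1) ⊕ Fin k :=
    Sum.elim (Sum.elim (fun j => Sum.inl j.succ) Sum.inr) (fun _ => Sum.inl 0)
  let e2f : (Fin k ⊕ Fin k) ⊕ Unit → Fin (k + 1) ⊕ Fin k :=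
    Sum.elim (Sum.elim (fun j => Sum.inl j.castSucc) Sum.inr) (fun _ => Sum.inl (Fin.last k))
  have hcard : Fintype.card ((Fin k ⊕ Fin k) ⊕ Unit) = Fintype.card (Fin (k + 1) ⊕ Fin k) := by
    simp; omega
  have he1 : Function.Bijective e1f := by
    rw [Fintype.bijective_iff_injective_and_card]
    refine ⟨?_, hcard⟩
    rintro ((i | i) | i) ((j | j) | j) h <;> simp [e1f, Fin.succ_ne_zero, (Fin.succ_ne_zero _).symm] at h ⊢ <;> exact h
  have he2 : Function.Bijective e2f := by
    rw [Fintype.bijective_iff_injective_and_card]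
    refine ⟨?_, hcard⟩
    rintro ((i | i) | i) ((j | j) | j) h <;> simp [e2f, Fin.castSucc_ne_last, (Fin.castSucc_ne_last _).symm] at h ⊢ <;> exact h
  obtain ⟨P0, P1, hP0, hP1, ht0, ht1, hM⟩ := aux_pair ((Equiv.ofBijective e1f he1).trans g)
    (fun i => m₀ (g.symm i)) (b 0 - a 0) (b 1 - a 1) (hc 0) (hc 1)
    (by intro i; simp [e1f, m₀, hc₁₂])
    (by
      intro i h
      simp [e1f, m₀] at h
      refine hne (2 * (i + 1)) (by omega) (by omega) ?_
      push_cast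
      linear_combination -h)
    (by simp [e1f, m₀])
  obtain ⟨P2, P3, hP2, hP3, ht2, ht3, hN⟩ := aux_pair ((Equiv.ofBijective e2f he2).trans g)
    (fun i => s - m₀ (g.symm i)) (b 2 - a 2) (b 3 - a 3) (hc 2) (hc 3)
    (by intro i; simp [e2f, m₀]; linear_combination 2 * hsδ - hrel)
    (by
      intro i h
      simp [e2f, m₀] at h
      refine hne (2 * i + 1) (by omega) (by omega) ?_
      push_cast
      linear_combination -h)
    (by simp [e2f, m₀]; linear_combination hsδ)
  let P : Fin 4 → Matrix (Fin n) (Fin n) ℂ := ![P0, P1, P2, P3]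
  have hP : ∀ j, P j * P j = P j := by intro j; fin_cases j <;> assumption
  have ht : ∀ j, (P j).trace = k := by intro j; fin_cases j <;> assumption
  let A : Fin 4 → Matrix (Fin n) (Fin n) ℂ := fun j =>
    a j • (1 : Matrix (Fin n) (Fin n) ℂ) + (b j - a j) • P j
  have hA : ∑ j, A j = 0 := by
    have hMN : diagonal (fun i => m₀ (g.symm i)) + diagonal (fun i => s - m₀ (g.symm i))
        = s • (1 : Matrix (Fin n) (Fin n) ℂ) := by
      rw [diagonal_add, smul_one_eq_diagonal]
      congr 1; funext i; ring
    rw [← hM, ← hN, hs] at hMN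
    simp only [Fin.sum_univ_four, A, P]
    simp only [neg_smul, add_smul] at hMN
    rw [← sub_eq_zero] at hMN
    rw [← hMN]
    simp
    abel
  refine ⟨A, hA, ?_, fun j => aux_conj (d j) (a j) (b j) (hd j) (hab j) (hb j) (P j) (hP j) (ht j)⟩
  intro V hV
  have hVA : ∀ j, ∀ v ∈ V, Matrix.toLin' (A j) v ∈ V := fun j v hv =>
    hV j (Submodule.mem_map_of_mem hv)
  have hAP : ∀ j v, Matrix.toLin' (A j) v = a j • v + (b j - a j) • Matrix.toLin' (P j) v := by
    intro j v
    simp [A, Matrix.add_mulVec, Matrix.smul_mulVec]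
  have hVP : ∀ j, ∀ v ∈ V, Matrix.toLin' (P j) v ∈ V := by
    intro j v hv
    have h1 := hVA j v hv
    rw [hAP] at h1
    have h2 := (V.add_mem_iff_right (V.smul_mem (a j) hv)).1 h1
    exact (V.smul_mem_iff (hc j)).1 h2
  choose t h1 h2 h3 h4 using fun j => aux_restrict hn (P j) (hP j) (ht j) V (hVP j)
  by_contra hcon
  push Not at hcon
  have hpos : 1 ≤ Module.finrank ℂ V := by
    by_contra h
    exact hcon.1 (Submodule.finrank_eq_zero.1 (by omega))
  have hlt : Module.finrank ℂ V ≤ 2 * k := by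
    have := Submodule.finrank_lt hcon.2
    simp at this
    omega
  refine G _ hpos hlt t h1 h2 h3 ?_
  have hz : ∑ j, (a j • (LinearMap.id : V →ₗ[ℂ] V)
      + (b j - a j) • (Matrix.toLin' (P j)).restrict (hVP j)) = 0 := by
    ext v : 2
    have : Matrix.toLin' (∑ j, A j) (v : Fin n → ℂ) = 0 := by rw [hA]; simp
    rw [map_sum, LinearMap.sum_apply] at this
    simp only [hAP] at this
    simpa [LinearMap.sum_apply] using this
  have := congrArg (LinearMap.trace ℂ V) hz
  rw [map_sum, map_zero] at this
  rw [← this]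
  refine Finset.sum_congr rfl fun j _ => ?_
  rw [map_add, map_smul, map_smul, h4, LinearMap.trace_id]
  simp; ring
end

section
/- Let k ≥ 1 and n = 4k. For every choice of generic eigenvalues compatible with the quintuple of multiplicity vectors T_k : Λ₁ = (2k+1, 2k−1), Λ₂ = Λ₃ = Λ₄ = Λ₅ = (3k, k), there exists an irreducible quintuple of diagonalizable matrices A₁,…,A₅ ∈ gl(n,ℂ) with A₁ + A₂ + A₃ + A₄ + A₅ = 0, where A_j has distinct eigenvalues with multiplicities given by Λ_j equal to the chosen generic eigenvalues. (This quintuple of multiplicity vectors is rigid: Σ_j d_j = 2n² − 2.) -/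
open Matrix BigOperators

lemma trace_idem {V : Type*} [AddCommGroup V] [Module ℂ V] [FiniteDimensional ℂ V]
    (f : V →ₗ[ℂ] V) (hf : f * f = f) :
    LinearMap.trace ℂ V f = (Module.finrank ℂ (LinearMap.range f) : ℂ) :=
  ((LinearMap.isProj_range_iff_isIdempotentElem f).2 hf).trace

lemma factor_idem {ι κ : Type*} [Fintype ι] [DecidableEq ι] [Fintype κ] [DecidableEq κ]
    (P : Matrix ι ι ℂ) (hP : P * P = P) (ht : P.trace = Fintype.card κ) :
    ∃ (Y : Matrix ι κ ℂ) (X : Matrix κ ι ℂ), Y * X = P ∧ X * Y = 1 := by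
  have hidem : (Matrix.toLin' P) * (Matrix.toLin' P) = Matrix.toLin' P := by
    rw [Module.End.mul_eq_comp, ← Matrix.toLin'_mul, hP]
  have hproj := (LinearMap.isProj_range_iff_isIdempotentElem (Matrix.toLin' P)).2 hidem
  have hr : Module.finrank ℂ (LinearMap.range (Matrix.toLin' P)) = Fintype.card κ := by
    have := trace_idem _ hidem
    rw [Matrix.trace_toLin'_eq, ht] at this
    exact_mod_cast this.symm
  let b : Module.Basis κ ℂ (LinearMap.range (Matrix.toLin' P)) :=
    (Module.finBasisOfFinrankEq ℂ _ hr).reindex (Fintype.equivFin κ).symm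
  let c := Pi.basisFun ℂ ι
  refine ⟨LinearMap.toMatrix b c (Submodule.subtype _), LinearMap.toMatrix c b hproj.codRestrict, ?_, ?_⟩
  · rw [← LinearMap.toMatrix_comp c b c, hproj.subtype_comp_codRestrict]
    exact LinearMap.toMatrix'_toLin' P
  · rw [← LinearMap.toMatrix_comp b c b]
    convert LinearMap.toMatrix_id b
    ext x
    simp

lemma conj_of_idem {n : ℕ} (f : Fin n → ℂ) (a b : ℂ) (hab : a ≠ b) (hf : ∀ i, f i = a ∨ f i = b)
    (P : Matrix (Fin n) (Fin n) ℂ) (hP : P * P = P)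
    (ht : P.trace = ((Finset.univ.filter fun i => f i = b).card : ℂ)) :
    MatConj (diagonal f) (a • (1 : Matrix _ _ ℂ) + (b - a) • P) := by
  have hc : Fintype.card {i // f i = b} = (Finset.univ.filter fun i => f i = b).card :=
    Fintype.card_subtype _
  have hc2 := Fintype.card_subtype_compl (fun i => f i = b)
  have hle := Fintype.card_subtype_le (fun i => f i = b)
  obtain ⟨Y1, X1, h1, h1'⟩ := factor_idem (κ := {i // f i = b}) P hP (by rw [ht, hc])
  have hP' : (1 - P) * (1 - P) = 1 - P := by simp [mul_sub, sub_mul, hP]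
  obtain ⟨Y2, X2, h2, h2'⟩ := factor_idem (κ := {i // ¬ f i = b}) (1 - P) hP' (by
    rw [trace_sub, ht, ← hc, hc2, Nat.cast_sub hle]; simp)
  have h12 : X1 * Y2 = 0 := by
    have : X1 * Y2 = (X1 * Y1) * X1 * Y2 * (X2 * Y2) := by simp [h1', h2']
    rw [this, show (X1 * Y1) * X1 * Y2 * (X2 * Y2) = X1 * ((Y1 * X1) * (Y2 * X2)) * Y2 by
      simp only [Matrix.mul_assoc], h1, h2]
    simp [mul_sub, hP]
  have h21 : X2 * Y1 = 0 := by
    have : X2 * Y1 = (X2 * Y2) * X2 * Y1 * (X1 * Y1) := by simp [h1', h2']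
    rw [this, show (X2 * Y2) * X2 * Y1 * (X1 * Y1) = X2 * ((Y2 * X2) * (Y1 * X1)) * Y1 by
      simp only [Matrix.mul_assoc], h1, h2]
    simp [sub_mul, hP]
  let e := (Equiv.sumCompl (fun i => f i = b))
  let S : Matrix (Fin n) (Fin n) ℂ := (fromCols Y1 Y2).submatrix id e.symm
  let T : Matrix (Fin n) (Fin n) ℂ := (fromRows X1 X2).submatrix e.symm id
  have hST : S * T = 1 := by
    simp only [S, T]
    rw [submatrix_mul_equiv, fromCols_mul_fromRows, h1, h2]; simp
  have hTS : T * S = 1 := mul_eq_one_comm.1 hST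
  refine ⟨⟨S, T, hST, hTS⟩, ?_⟩
  change _ = S * diagonal f * T
  have hd : diagonal f = (fromBlocks (b • (1 : Matrix {i // f i = b} {i // f i = b} ℂ)) 0 0
      (a • (1 : Matrix {i // ¬ f i = b} {i // ¬ f i = b} ℂ))).submatrix e.symm e.symm := by
    ext i j
    obtain ⟨i, rfl⟩ := e.surjective i
    obtain ⟨j, rfl⟩ := e.surjective j
    simp only [submatrix_apply, Equiv.symm_apply_apply, diagonal_apply, e.injective.eq_iff]
    rcases i with i | i <;> rcases j with j | j
    · have := i.2
      simp [e, Matrix.one_apply, this]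
    · simp
    · simp
    · have := (hf i).resolve_right i.2
      simp [e, Matrix.one_apply, this]
  rw [hd]
  simp only [S, T]
  rw [submatrix_mul_equiv, submatrix_mul_equiv, fromCols_mul_fromBlocks, fromCols_mul_fromRows]
  simp [h1, h2]
  module

lemma two_values {n : ℕ} (f : Fin n → ℂ) (r s : ℕ) (h : evCounts f = ({r, s} : Multiset ℕ)) :
    ∃ a b, a ≠ b ∧ (∀ i, f i = a ∨ f i = b) ∧ (Finset.univ.filter fun i => f i = a).card = r ∧
      (Finset.univ.filter fun i => f i = b).card = s := by
  classical
  unfold evCounts at h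
  have h' : Multiset.map (fun σ => (Finset.univ.filter fun k => f k = σ).card) (Finset.univ.image f).val = r ::ₘ {s} := by
    rw [← Multiset.insert_eq_cons]; convert h
  obtain ⟨a, ha, har, h2⟩ := (Multiset.map_eq_cons _ _ _ _).2 h'
  obtain ⟨b, hb, hbs⟩ := Multiset.map_eq_singleton.1 h2
  have hv : (Finset.univ.image f).val = a ::ₘ {b} := by
    rw [← hb, Multiset.cons_erase ha]
  have hnd := (Finset.univ.image f).nodup
  rw [hv] at hnd
  refine ⟨a, b, by simpa using hnd, fun i => ?_, har, hbs⟩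
  have : f i ∈ (Finset.univ.image f).val := by
    exact Finset.mem_image_of_mem f (Finset.mem_univ i)
  rw [hv] at this; simpa using this

/-- A subset with prescribed numbers of entries. -/
lemma choose_subset {n : ℕ} (f : Fin n → ℂ) (a b : ℂ) (hab : a ≠ b) (s t : ℕ)
    (hs : s ≤ (Finset.univ.filter fun i => f i = a).card)
    (ht : t ≤ (Finset.univ.filter fun i => f i = b).card) :
    ∃ Φ : Finset (Fin n), Φ.card = s + t ∧ ∑ i ∈ Φ, f i = s * a + t * b := by
  obtain ⟨A, hA, hAc⟩ := Finset.exists_subset_card_eq hs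
  obtain ⟨B, hB, hBc⟩ := Finset.exists_subset_card_eq ht
  have hd : Disjoint A B := by
    rw [Finset.disjoint_left]
    intro i hi hj
    have h1 := hA hi
    have h2 := hB hj
    simp only [Finset.mem_filter, Finset.mem_univ, true_and] at h1 h2
    exact hab (h1.symm.trans h2)
  refine ⟨A ∪ B, by rw [Finset.card_union_of_disjoint hd, hAc, hBc], ?_⟩
  rw [Finset.sum_union hd, Finset.sum_congr rfl (g := fun _ => a), Finset.sum_congr (s₁ := B) rfl (g := fun _ => b)]
  · simp [hAc, hBc]
  · intro i hi; simpa using hB hi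
  · intro i hi; simpa using hA hi

lemma restrict_trace {n : ℕ} (f : Fin n → ℂ) (a b : ℂ) (hab : a ≠ b) 
    (P : Matrix (Fin n) (Fin n) ℂ) (hP : P * P = P) (r s : ℕ) (hrs : r + s = n)
    (hr : (Finset.univ.filter fun i => f i = a).card = r)
    (hs : (Finset.univ.filter fun i => f i = b).card = s)
    (ht : P.trace = s) (V : Submodule ℂ (Fin n → ℂ))
    (hV : ∀ x ∈ V, mulVecLin (a • (1 : Matrix _ _ ℂ) + (b - a) • P) x ∈ V) :
    ∃ Φ : Finset (Fin n), Φ.card = Module.finrank ℂ V ∧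
      ∑ i ∈ Φ, f i = LinearMap.trace ℂ V ((mulVecLin (a • (1 : Matrix _ _ ℂ) + (b - a) • P)).restrict hV) := by
  have hba : b - a ≠ 0 := sub_ne_zero.2 hab.symm
  have hVP : ∀ x ∈ V, mulVecLin P x ∈ V := by
    intro x hx
    have h := hV x hx
    have : mulVecLin P x = (b - a)⁻¹ • (mulVecLin (a • (1 : Matrix _ _ ℂ) + (b - a) • P) x - a • x) := by
      simp [Matrix.add_mulVec, Matrix.smul_mulVec, smul_smul, inv_mul_cancel₀ hba]
    rw [this]
    exact V.smul_mem _ (V.sub_mem h (V.smul_mem _ hx))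
  have hPP : ∀ x, mulVecLin P (mulVecLin P x) = mulVecLin P x := by
    intro x; simp [hP]
  have rk : ∀ (Q : Matrix (Fin n) (Fin n) ℂ) (hQ : Q * Q = Q) (s : ℕ) (hs : Q.trace = s)
      (hVQ : ∀ x ∈ V, mulVecLin Q x ∈ V), ∃ t : ℕ, t ≤ s ∧
      LinearMap.trace ℂ V ((mulVecLin Q).restrict hVQ) = t := by
    intro Q hQ s hs hVQ
    have hQQ : ∀ x, mulVecLin Q (mulVecLin Q x) = mulVecLin Q x := by
      intro x; simp [hQ]
    have h1 := trace_idem (mulVecLin Q) (by ext1; simp [Module.End.mul_eq_comp, ← mulVecLin_mul, hQ])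
    have h1' : LinearMap.trace ℂ _ (mulVecLin Q) = s := by
      rw [← hs]; exact Matrix.trace_toLin'_eq Q
    rw [h1'] at h1
    have h2 := trace_idem ((mulVecLin Q).restrict hVQ) (by
      ext1 x; apply Subtype.ext; exact hQQ x)
    refine ⟨_, ?_, h2⟩
    have h1 : s = Module.finrank ℂ (LinearMap.range (mulVecLin Q)) := by exact_mod_cast h1
    rw [h1, ← Submodule.finrank_map_subtype_eq]
    apply Submodule.finrank_mono
    rintro _ ⟨_, ⟨x, rfl⟩, rfl⟩
    exact ⟨x, rfl⟩
  obtain ⟨t, hts, htt⟩ := rk P hP s ht hVP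
  have hP' : (1 - P) * (1 - P) = 1 - P := by simp [mul_sub, sub_mul, hP]
  have hVP' : ∀ x ∈ V, mulVecLin (1 - P) x ∈ V := by
    intro x hx
    have : mulVecLin (1 - P) x = x - mulVecLin P x := by simp [Matrix.sub_mulVec]
    rw [this]; exact V.sub_mem hx (hVP x hx)
  obtain ⟨u, hur, huu⟩ := rk (1 - P) hP' r (by rw [trace_sub, ht]; simp [← hrs]) hVP'
  have e1 : (mulVecLin (1 - P)).restrict hVP' = LinearMap.id - (mulVecLin P).restrict hVP := by
    ext1 x; apply Subtype.ext; simp [Matrix.sub_mulVec]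
  have e2 : (mulVecLin (a • (1 : Matrix _ _ ℂ) + (b - a) • P)).restrict hV =
      a • LinearMap.id + (b - a) • (mulVecLin P).restrict hVP := by
    ext1 x; apply Subtype.ext; simp [Matrix.add_mulVec, Matrix.smul_mulVec]
  rw [e1] at huu
  replace huu := (map_sub (LinearMap.trace ℂ V) LinearMap.id ((mulVecLin P).restrict hVP)).symm.trans huu
  rw [htt, LinearMap.trace_id] at huu
  obtain ⟨Φ, h1, h2⟩ := choose_subset f a b hab u t (by omega) (by omega)
  have h3 : u + t = Module.finrank ℂ V := by
    have : (Module.finrank ℂ V : ℂ) = u + t := by linear_combination huu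
    exact_mod_cast this.symm
  refine ⟨Φ, by rw [h1, h3], ?_⟩
  rw [e2, map_add, map_smul, map_smul, htt, LinearMap.trace_id, h2, ← h3]
  simp; ring

lemma two_by_two (ν₁ ν₂ y : ℂ) (h1 : ν₁ ≠ 0) (h2 : ν₂ ≠ 0) (hy : 2 * y - (ν₁ + ν₂) ≠ 0) :
    ∃ p q : Matrix (Fin 2) (Fin 2) ℂ, p * p = p ∧ q * q = q ∧ p.trace = 1 ∧ q.trace = 1 ∧
      ν₁ • p + ν₂ • q = diagonal ![y, ν₁ + ν₂ - y] := by
  obtain ⟨P, hP⟩ : ∃ P, P * (ν₁ * (2 * y - (ν₁ + ν₂))) = y * (y - ν₂) :=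
    ⟨y * (y - ν₂) / (ν₁ * (2 * y - (ν₁ + ν₂))), div_mul_cancel₀ _ (mul_ne_zero h1 hy)⟩
  obtain ⟨Q, hQ⟩ : ∃ Q, ν₂ * Q = y - ν₁ * P := ⟨(y - ν₁ * P) / ν₂, by field_simp⟩
  obtain ⟨r, hr⟩ : ∃ r, ν₂ * r = ν₁ := ⟨ν₁ / ν₂, by field_simp⟩
  have key : ν₂ ^ 2 * (Q * (1 - Q)) = ν₁ ^ 2 * (P * (1 - P)) := by
    have : ν₂ ^ 2 * (Q * (1 - Q)) = (ν₂ * Q) * (ν₂ - ν₂ * Q) := by ring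
    rw [this, hQ]; linear_combination hP
  have key2 : Q * (1 - Q) = r ^ 2 * (P * (1 - P)) := by
    apply mul_left_cancel₀ (pow_ne_zero 2 h2)
    rw [key, ← hr]; ring
  refine ⟨!![P, 1; P * (1 - P), 1 - P], !![Q, -r; -r * (P * (1 - P)), 1 - Q], ?_, ?_, ?_, ?_, ?_⟩
  · ext i j; fin_cases i <;> fin_cases j <;> simp [Matrix.mul_apply, Fin.sum_univ_two] <;> ring
  · ext i j; fin_cases i <;> fin_cases j <;> simp [Matrix.mul_apply, Fin.sum_univ_two]
    · linear_combination -key2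
    · ring
    · ring
    · linear_combination -key2
  · simp [Matrix.trace, Fin.sum_univ_two]
  · simp [Matrix.trace, Fin.sum_univ_two]
  · ext i j; fin_cases i <;> fin_cases j <;> simp
    · linear_combination hQ
    · linear_combination -hr
    · linear_combination -(P * (1 - P)) * hr
    · linear_combination -hQ

noncomputable def xseq (s δ : ℂ) (i : ℕ) : ℂ :=
  if i % 2 = 0 then ((i / 2 : ℕ) : ℂ) * δ else s - (((i + 1) / 2 : ℕ) : ℂ) * δ

lemma two_proj (m : ℕ) (ν₁ ν₂ δ : ℂ) (h1 : ν₁ ≠ 0) (h2 : ν₂ ≠ 0)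
    (hδ : ∀ j : ℕ, 1 ≤ j → j ≤ m → ν₁ + ν₂ ≠ 2 * j * δ) :
    ∃ p q : Matrix (Fin (1 + m * 2)) (Fin (1 + m * 2)) ℂ,
      p * p = p ∧ q * q = q ∧ p.trace = m ∧ q.trace = m ∧
      ν₁ • p + ν₂ • q = diagonal (fun i : Fin (1 + m * 2) => xseq (ν₁ + ν₂) δ i) := by
  have H : ∀ j : Fin m, ∃ p q : Matrix (Fin 2) (Fin 2) ℂ, p * p = p ∧ q * q = q ∧
      p.trace = 1 ∧ q.trace = 1 ∧
      ν₁ • p + ν₂ • q = diagonal ![(ν₁ + ν₂) - (j + 1 : ℕ) * δ, (j + 1 : ℕ) * δ] := by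
    intro j
    have := hδ (j + 1) (by omega) (by omega)
    obtain ⟨p, q, a, b, c, d, e⟩ := two_by_two ν₁ ν₂ ((ν₁ + ν₂) - (j + 1 : ℕ) * δ) h1 h2 (by
      intro h; apply this; linear_combination h)
    refine ⟨p, q, a, b, c, d, ?_⟩
    rw [e]; simp
  choose p q hp hq tp tq hpq using H
  let e : Fin 1 ⊕ (Fin m × Fin 2) ≃ Fin (1 + m * 2) :=
    (Equiv.sumCongr (Equiv.refl _) finProdFinEquiv).trans finSumFinEquiv
  let e' : Fin 1 ⊕ (Fin 2 × Fin m) ≃ Fin (1 + m * 2) :=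
    (Equiv.sumCongr (Equiv.refl _) (Equiv.prodComm _ _)).trans e
  let P : (Fin m → Matrix (Fin 2) (Fin 2) ℂ) → Matrix (Fin (1 + m * 2)) (Fin (1 + m * 2)) ℂ :=
    fun p => (fromBlocks (0 : Matrix (Fin 1) (Fin 1) ℂ) 0 0 (blockDiagonal p)).submatrix e'.symm e'.symm
  have hmul : ∀ p, (∀ j, p j * p j = p j) → P p * P p = P p := by
    intro p hp
    simp only [P]
    rw [Matrix.submatrix_mul_equiv, fromBlocks_multiply, ← blockDiagonal_mul]
    simp [hp]
  have htr : ∀ p, (∀ j, (p j).trace = 1) → (P p).trace = m := by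
    intro p hp
    simp only [P, Matrix.trace, diag_apply, submatrix_apply]
    rw [Equiv.sum_comp e'.symm (fun i => fromBlocks (0 : Matrix (Fin 1) (Fin 1) ℂ) 0 0 (blockDiagonal p) i i)]
    have := trace_blockDiagonal p
    simp [hp] at this
    simp only [Matrix.trace, diag_apply] at this
    simp [Fintype.sum_sum_type, this]
  refine ⟨P p, P q, hmul p hp, hmul q hq, htr p tp, htr q tq, ?_⟩
  have : ν₁ • P p + ν₂ • P q = P (fun j => ν₁ • p j + ν₂ • q j) := by
    ext i j
    simp only [P, Matrix.add_apply, Matrix.smul_apply, submatrix_apply]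
    generalize e'.symm i = i
    generalize e'.symm j = j
    rcases i with a | ⟨a, b⟩ <;> rcases j with c | ⟨c, d⟩
    · simp
    · simp
    · simp
    · simp only [fromBlocks_apply₂₂, blockDiagonal_apply]
      split_ifs <;> simp
  rw [this]
  simp only [hpq]
  ext i j
  obtain ⟨i, rfl⟩ := e'.surjective i
  obtain ⟨j, rfl⟩ := e'.surjective j
  simp only [P, submatrix_apply, Equiv.symm_apply_apply, diagonal_apply, e'.injective.eq_iff]
  rcases i with a | ⟨a, b⟩ <;> rcases j with c | ⟨c, d⟩
  · have : a = c := Subsingleton.elim _ _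
    subst this
    have : a = 0 := Subsingleton.elim _ _
    simp [e', e, xseq, this]
  · simp
  · simp
  · have hv : ((e' (Sum.inr (a, b)) : Fin _) : ℕ) = 1 + (a + 2 * b) := by simp [e', e]
    rw [hv]
    simp only [fromBlocks_apply₂₂, blockDiagonal_apply, diagonal_apply, Sum.inr.injEq, Prod.mk.injEq]
    by_cases h : b = d
    · subst h
      by_cases h' : a = c
      · subst h'
        fin_cases a
        · have : (1 + 2 * (b : ℕ)) % 2 = 1 := by omega
          have h2 : (1 + 2 * (b : ℕ) + 1) / 2 = b + 1 := by omega
          simp [xseq, this, h2]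
        · have : (1 + (1 + 2 * (b : ℕ))) % 2 = 0 := by omega
          have h2 : (1 + (1 + 2 * (b : ℕ))) / 2 = b + 1 := by omega
          simp [xseq, this, h2]
      · simp [h']
    · simp [h]

lemma four_proj (m : ℕ) (ν : Fin 4 → ℂ) (δ : ℂ) (hν : ∀ i, ν i ≠ 0)
    (hs : ∑ i, ν i = (2 * m + 1) * δ)
    (hδ : ∀ j : ℕ, 1 ≤ j → j ≤ 2 * m → ν 0 + ν 1 ≠ j * δ) :
    ∃ S : Fin 4 → Matrix (Fin (1 + m * 2)) (Fin (1 + m * 2)) ℂ,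
      (∀ i, S i * S i = S i) ∧ (∀ i, (S i).trace = m + 1) ∧
      ∑ i, ν i • S i = ((m + 1) * δ) • (1 : Matrix _ _ ℂ) := by
  rw [Fin.sum_univ_four] at hs
  obtain ⟨p, q, hp, hq, tp, tq, hpq⟩ := two_proj m (ν 0) (ν 1) δ (hν 0) (hν 1) (by
    intro j h1 h2
    have := hδ (2 * j) (by omega) (by omega)
    push_cast at this; exact this)
  obtain ⟨p', q', hp', hq', tp', tq', hpq'⟩ := two_proj m (ν 2) (ν 3) δ (hν 2) (hν 3) (by
    intro j h1 h2 h
    have := hδ (2 * m + 1 - 2 * j) (by omega) (by omega)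
    apply this
    rw [Nat.cast_sub (by omega)]
    push_cast; linear_combination hs - h)
  let r : Matrix (Fin (1 + m * 2)) (Fin (1 + m * 2)) ℂ → Matrix (Fin (1 + m * 2)) (Fin (1 + m * 2)) ℂ :=
    fun p => p.submatrix Fin.revPerm Fin.revPerm
  have rm : ∀ p, p * p = p → r p * r p = r p := by
    intro p hp; simp only [r]; rw [submatrix_mul_equiv, hp]
  have rt : ∀ p, (r p).trace = p.trace := by
    intro p; simp only [r, Matrix.trace, diag_apply, submatrix_apply]
    exact Equiv.sum_comp Fin.revPerm (fun i => p i i)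
  have idc : ∀ {p : Matrix (Fin (1 + m * 2)) (Fin (1 + m * 2)) ℂ}, p * p = p → (1 - p) * (1 - p) = 1 - p := by
    intro p hp; simp [mul_sub, sub_mul, hp]
  have trc : ∀ {p : Matrix (Fin (1 + m * 2)) (Fin (1 + m * 2)) ℂ}, p.trace = m → (1 - p).trace = m + 1 := by
    intro p hp; simp [trace_sub, hp]; ring
  refine ⟨![1 - p, 1 - q, 1 - r p', 1 - r q'], ?_, ?_, ?_⟩
  · intro i; fin_cases i
    exacts [idc hp, idc hq, idc (rm _ hp'), idc (rm _ hq')]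
  · intro i; fin_cases i
    exacts [trc tp, trc tq, trc ((rt _).trans tp'), trc ((rt _).trans tq')]
  · have h2 : ν 2 • r p' + ν 3 • r q' = r (diagonal (fun i : Fin (1 + m * 2) => xseq (ν 2 + ν 3) δ i)) := by
      rw [← hpq']; rfl
    have h3 : (diagonal (fun i : Fin (1 + m * 2) => xseq (ν 0 + ν 1) δ i) : Matrix _ _ ℂ) + r (diagonal (fun i : Fin (1 + m * 2) => xseq (ν 2 + ν 3) δ i)) = (m * δ) • 1 := by
      ext i j
      simp only [r, Matrix.add_apply, submatrix_apply, diagonal_apply, Matrix.smul_apply, one_apply,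
        Fin.revPerm.injective.eq_iff]
      by_cases h : i = j
      · subst h
        simp only [if_true, Fin.revPerm_apply, Fin.val_rev, xseq, smul_eq_mul, mul_one]
        have hi := i.2
        obtain ⟨c, hc | hc⟩ : ∃ c, (i : ℕ) = 2 * c ∨ (i : ℕ) = 2 * c + 1 := ⟨i / 2, by omega⟩
        · obtain ⟨d, rfl⟩ : ∃ d, m = c + d := ⟨m - c, by omega⟩
          rw [if_pos (by omega), if_pos (by omega),
            show (i : ℕ) / 2 = c by omega, show (1 + (c + d) * 2 - (i + 1)) / 2 = d by omega]
          push_cast; ring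
        · obtain ⟨d, rfl⟩ : ∃ d, m = c + d + 1 := ⟨m - c - 1, by omega⟩
          rw [if_neg (by omega), if_neg (by omega),
            show ((i : ℕ) + 1) / 2 = c + 1 by omega,
            show (1 + (c + d + 1) * 2 - (i + 1) + 1) / 2 = d + 1 by omega]
          push_cast at hs ⊢; linear_combination hs
      · simp [h]
    have h4 := hpq ▸ h2 ▸ h3
    rw [Fin.sum_univ_four]
    have : ((m + 1) * δ) • (1 : Matrix (Fin (1 + m * 2)) (Fin (1 + m * 2)) ℂ) =
       (ν 0 + ν 1 + ν 2 + ν 3) • 1 - (m * δ) • 1 := by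
      rw [hs, ← sub_smul]; congr 1; ring
    rw [this, ← h4]
    simp only [cons_val]
    module

lemma irred_of_generic_s11 {n : ℕ} (d : Fin 5 → Fin n → ℂ) (hgen : GenericAddEV d)
    (a b : Fin 5 → ℂ) (hab : ∀ j, a j ≠ b j) (r s : Fin 5 → ℕ) (hrs : ∀ j, r j + s j = n)
    (hr : ∀ j, (Finset.univ.filter fun i => d j i = a j).card = r j)
    (hs : ∀ j, (Finset.univ.filter fun i => d j i = b j).card = s j)
    (P : Fin 5 → Matrix (Fin n) (Fin n) ℂ) (hP : ∀ j, P j * P j = P j)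
    (ht : ∀ j, (P j).trace = s j)
    (h0 : ∑ j, (a j • (1 : Matrix (Fin n) (Fin n) ℂ) + (b j - a j) • P j) = 0) :
    IrreducibleTuple (fun j => a j • (1 : Matrix (Fin n) (Fin n) ℂ) + (b j - a j) • P j) := by
  intro V hV
  have hV' : ∀ j, ∀ x ∈ V,
      mulVecLin (a j • (1 : Matrix (Fin n) (Fin n) ℂ) + (b j - a j) • P j) x ∈ V :=
    fun j x hx => hV j ⟨x, hx, rfl⟩
  choose Φ hΦ hΦt using fun j => restrict_trace (d j) (a j) (b j) (hab j) (P j) (hP j) (r j) (s j)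
    (hrs j) (hr j) (hs j) (ht j) V (hV' j)
  by_contra hne
  push Not at hne
  have h1 : 1 ≤ Module.finrank ℂ V := by
    rw [Nat.one_le_iff_ne_zero]
    intro h; exact hne.1 (Submodule.finrank_eq_zero.1 h)
  have h2 : Module.finrank ℂ V < n := by
    have := Submodule.finrank_lt hne.2
    simpa using this
  apply hgen _ h1 (by omega) Φ hΦ
  simp only [hΦt]
  have : ∑ j, (mulVecLin (a j • (1 : Matrix (Fin n) (Fin n) ℂ) + (b j - a j) • P j)).restrict (hV' j) = 0 := by
    ext1 x
    apply Subtype.ext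
    have hx := congrArg (fun M => mulVecLin M (x : Fin n → ℂ)) h0
    simp only [Fin.sum_univ_five] at hx ⊢
    simpa [Matrix.add_mulVec] using hx
  have h3 := congrArg (LinearMap.trace ℂ V) this
  simp only [Fin.sum_univ_five] at h3 ⊢
  have e := fun f g => map_add (LinearMap.trace ℂ V) f g
  rw [← e, ← e, ← e, ← e]
  exact h3.trans (map_zero _)

lemma core_exist (m : ℕ) (μ : Fin 4 → ℂ) (α ρ δ : ℂ) (hρ : ρ = (m + 1) * δ) (hρ0 : ρ ≠ 0)
    (hμ : ∀ i, μ i ≠ 0) (hν : ∀ i, μ i - α ≠ 0)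
    (hs : ∑ i, (μ i - α) = (2 * m + 1) * δ)
    (hδ : ∀ j : ℕ, 1 ≤ j → j ≤ 2 * m → (μ 0 - α) + (μ 1 - α) ≠ j * δ) :
    ∃ (Q : Fin 4 → Matrix (Fin 4 × Fin (m + 1)) (Fin 4 × Fin (m + 1)) ℂ)
      (T : Matrix (Fin 4 × Fin (m + 1)) (Fin 4 × Fin (m + 1)) ℂ),
      (∀ i, Q i * Q i = Q i) ∧ (∀ i, (Q i).trace = m + 1) ∧ T * T = T ∧ T.trace = 2 * m + 1 ∧
      ∑ i, μ i • Q i = α • (1 : Matrix _ _ ℂ) + ρ • T := by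
  obtain ⟨S, hS, hSt, hSs⟩ := four_proj m (fun i => μ i - α) δ hν hs hδ
  choose y x hyx hxy using fun i => factor_idem (κ := Fin (m + 1)) (S i) (hS i) (by rw [hSt]; simp)
  let X : Matrix (Fin 4 × Fin (m + 1)) (Fin (1 + m * 2)) ℂ := fun p l => (μ p.1 - α) * x p.1 p.2 l
  let Y : Matrix (Fin (1 + m * 2)) (Fin 4 × Fin (m + 1)) ℂ := fun l p => y p.1 l p.2
  have hYX : Y * X = ρ • (1 : Matrix _ _ ℂ) := by
    rw [hρ, ← hSs]
    ext l l'
    rw [Matrix.mul_apply, Fintype.sum_prod_type, Matrix.sum_apply]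
    refine Finset.sum_congr rfl fun i _ => ?_
    rw [Matrix.smul_apply, ← hyx, Matrix.mul_apply, smul_eq_mul, Finset.mul_sum]
    refine Finset.sum_congr rfl fun c _ => ?_
    simp only [X, Y]; ring
  have hXY : ∀ i c c', (X * Y) (i, c) (i, c') = (μ i - α) * (if c = c' then 1 else 0) := by
    intro i c c'
    rw [← Matrix.one_apply, ← hxy i, Matrix.mul_apply, Matrix.mul_apply, Finset.mul_sum]
    refine Finset.sum_congr rfl fun l _ => ?_
    simp only [X, Y]; ring
  let N : Matrix (Fin 4 × Fin (m + 1)) (Fin 4 × Fin (m + 1)) ℂ := α • 1 + X * Y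
  have hN : ∀ i c c', N (i, c) (i, c') = if c = c' then μ i else 0 := by
    intro i c c'
    simp only [N, Matrix.add_apply, Matrix.smul_apply, hXY, Matrix.one_apply, Prod.mk.injEq, true_and]
    split_ifs <;> simp
  let E : Fin 4 → Matrix (Fin 4 × Fin (m + 1)) (Fin 4 × Fin (m + 1)) ℂ :=
    fun i => diagonal (fun p => if p.1 = i then 1 else 0)
  have hENE : ∀ i, E i * N * E i = μ i • E i := by
    intro i
    ext ⟨p, c⟩ ⟨p', c'⟩
    simp only [E, Matrix.diagonal_mul, Matrix.mul_diagonal, Matrix.smul_apply, diagonal_apply, Prod.mk.injEq]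
    by_cases h : p = i
    · by_cases h' : p' = i
      · subst h; subst h'
        simp [hN]
      · have : p ≠ p' := fun e => h' (e ▸ h)
        simp [h', this]
    · simp [h]
  refine ⟨fun i => (μ i)⁻¹ • (E i * N), ρ⁻¹ • (X * Y), ?_, ?_, ?_, ?_, ?_⟩
  · intro i
    rw [smul_mul_smul_comm, ← Matrix.mul_assoc, hENE, Matrix.smul_mul, smul_smul]
    congr 1
    field_simp [hμ i]
  · intro i
    rw [trace_smul]
    have : (E i * N).trace = (m + 1) * μ i := by
      simp only [Matrix.trace, diag_apply, E, Matrix.diagonal_mul, Fintype.sum_prod_type, hN]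
      simp
    rw [this, smul_eq_mul]; field_simp [hμ i]
  · rw [smul_mul_smul_comm, show X * Y * (X * Y) = X * (Y * X) * Y by simp only [Matrix.mul_assoc],
      hYX, Matrix.mul_smul, Matrix.smul_mul, Matrix.mul_one, smul_smul]
    congr 1
    field_simp
  · rw [trace_smul, trace_mul_comm, hYX, trace_smul]
    simp [hρ0]; ring
  · have hE : ∑ i, E i = 1 := by
      ext ⟨p, c⟩ ⟨p', c'⟩
      simp only [E, Matrix.sum_apply, diagonal_apply, Matrix.one_apply]
      split_ifs <;> simp
    simp only [smul_smul, mul_inv_cancel₀ (hμ _), mul_inv_cancel₀ hρ0, one_smul]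
    rw [← Finset.sum_mul, hE, one_mul]

/-- existence of the rigid series `T_k`, `n = 4k`, PMV
`(2k+1,2k-1), (3k,k), (3k,k), (3k,k), (3k,k)`. -/
theorem stmt11 (k : ℕ) (hk : 1 ≤ k) (n : ℕ) (hn : n = 4 * k)
    (d : Fin 5 → Fin n → ℂ)
    (hmv0 : evCounts (d 0) = ({2 * k + 1, 2 * k - 1} : Multiset ℕ))
    (hmv : ∀ j, j ≠ 0 → evCounts (d j) = ({3 * k, k} : Multiset ℕ))
    (hsum : (∑ j, ∑ i, d j i) = 0)
    (hgen : GenericAddEV d) :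
    ∃ A : Fin 5 → Matrix (Fin n) (Fin n) ℂ,
      (∑ j, A j) = 0 ∧ IrreducibleTuple A ∧
      ∀ j, MatConj (Matrix.diagonal (d j)) (A j) := by
  obtain ⟨m, rfl⟩ : ∃ m, k = m + 1 := ⟨k - 1, by omega⟩
  subst hn
  let r : Fin 5 → ℕ := fun j => if j = 0 then 2 * m + 3 else 3 * (m + 1)
  let s : Fin 5 → ℕ := fun j => if j = 0 then 2 * m + 1 else m + 1
  have hmv' : ∀ j, evCounts (d j) = ({r j, s j} : Multiset ℕ) := by
    intro j
    by_cases h : j = 0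
    · subst h; rw [hmv0]; rfl
    · rw [hmv j h]; simp [r, s, h]
  have hrs : ∀ j, r j + s j = 4 * (m + 1) := by
    intro j; simp only [r, s]; split_ifs <;> omega
  choose a b hab hval hr hs using fun j => two_values (d j) (r j) (s j) (hmv' j)
  have htot : ∑ j, (r j * a j + s j * b j) = 0 := by
    rw [← hsum]
    refine Finset.sum_congr rfl fun j _ => ?_
    obtain ⟨Φ, h1, h2⟩ := choose_subset (d j) (a j) (b j) (hab j) (r j) (s j) (hr j).ge (hs j).ge
    have : Φ = Finset.univ := by
      apply Finset.eq_univ_of_card; rw [h1, hrs]; simp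
    rw [← h2, this]
  have hg : ∀ κ : ℕ, 1 ≤ κ → κ ≤ 4 * m + 3 → ∀ t : Fin 5 → ℕ, (∀ j, t j ≤ κ) → (∀ j, t j ≤ s j) →
      (∀ j, κ - t j ≤ r j) → ∑ j, ((κ - (t j : ℂ)) * a j + t j * b j) ≠ 0 := by
    intro κ h1 h2 t ht1 ht2 ht3 h
    choose Φ hΦ hΦ' using fun j => choose_subset (d j) (a j) (b j) (hab j) (κ - t j) (t j)
      (by rw [hr]; exact ht3 j) (by rw [hs]; exact ht2 j)
    apply hgen κ h1 (by omega) Φ (fun j => by rw [hΦ]; exact Nat.sub_add_cancel (ht1 j))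
    rw [← h]
    refine Finset.sum_congr rfl fun j _ => ?_
    rw [hΦ', Nat.cast_sub (ht1 j)]
  have hr0 : r 0 = 2 * m + 3 := rfl
  have hs0 : s 0 = 2 * m + 1 := rfl
  have hr1 : ∀ j : Fin 4, r j.succ = 3 * (m + 1) := fun j => by simp [r]
  have hs1 : ∀ j : Fin 4, s j.succ = m + 1 := fun j => by simp [s]
  have f0 : (Fin.succ 0 : Fin 5) = 1 := rfl
  have f1 : (Fin.succ 1 : Fin 5) = 2 := rfl
  have f2 : (Fin.succ 2 : Fin 5) = 3 := rfl
  have f3 : (Fin.succ 3 : Fin 5) = 4 := rfl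
  let C : ℂ := ∑ j : Fin 4, a j.succ
  let μ : Fin 4 → ℂ := fun j => b j.succ - a j.succ
  let α : ℂ := -C - a 0
  let ρ : ℂ := a 0 - b 0
  have hm0 : (m + 1 : ℂ) ≠ 0 := by exact_mod_cast Nat.succ_ne_zero m
  let δ : ℂ := ρ / (m + 1)
  have hρ : ρ = (m + 1) * δ := by simp only [δ]; field_simp
  have hνs : ∑ i, (μ i - α) = (2 * m + 1) * δ := by
    apply mul_left_cancel₀ hm0
    rw [show (m + 1 : ℂ) * ((2 * m + 1) * δ) = (2 * m + 1) * ((m + 1) * δ) by ring, ← hρ]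
    rw [Fin.sum_univ_succ] at htot
    simp only [hr0, hs0, hr1, hs1, Fin.sum_univ_four] at htot
    simp only [μ, α, ρ, C, Fin.sum_univ_four, f0, f1, f2, f3]
    push_cast at htot
    linear_combination htot
  have hg' : ∀ (q : ℕ) (t : Fin 4 → ℕ), 1 ≤ ∑ i, t i → ∑ i, t i ≤ 4 * m + 3 → (∀ i, t i ≤ m + 1) →
      q ≤ ∑ i, t i → q ≤ 2 * m + 1 → ∑ i, t i ≤ q + (2 * m + 3) → (∀ i, ∑ i, t i ≤ t i + 3 * (m + 1)) →
      ∑ i, (t i : ℂ) * (μ i - α) ≠ q * ρ := by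
    intro q t h1 h2 h3 h4 h5 h6 h7 h
    apply hg _ h1 h2 (Fin.cons q t)
    · intro j
      refine Fin.cases ?_ (fun i => ?_) j
      · simpa using h4
      · simpa using Finset.single_le_sum (f := t) (fun _ _ => Nat.zero_le _) (Finset.mem_univ i)
    · intro j
      refine Fin.cases ?_ (fun i => ?_) j
      · simpa [hs0] using h5
      · simpa [hs1] using h3 i
    · intro j
      refine Fin.cases ?_ (fun i => ?_) j
      · simp only [Fin.cons_zero, hr0]; omega
      · simp only [Fin.cons_succ, hr1]; have := h7 i; omega
    · rw [Fin.sum_univ_succ]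
      simp only [Fin.cons_zero, Fin.cons_succ]
      simp only [Fin.sum_univ_four, μ, α, ρ, C, f0, f1, f2, f3] at h ⊢
      push_cast
      linear_combination h
  have hν : ∀ i, μ i - α ≠ 0 := by
    intro i h
    have := hg' 0 (Pi.single i 1) 
    simp only [Finset.sum_pi_single', Finset.mem_univ, if_true] at this
    apply this
    · omega
    · omega
    · intro j; by_cases h : j = i
      · subst h; simp
      · simp [h]
    · omega
    · omega
    · omega
    · intro j; omega
    · rw [Finset.sum_eq_single i]
      · simp [h]
      · intro j _ hj; simp [hj]
      · simp
  have hδ : ∀ j : ℕ, 1 ≤ j → j ≤ 2 * m → (μ 0 - α) + (μ 1 - α) ≠ j * δ := by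
    intro j h1 h2 h
    rw [Fin.sum_univ_four] at hνs
    by_cases hj : j ≤ m
    · refine hg' (2 * j) ![j + 1, j + 1, j, j] ?_ ?_ ?_ ?_ ?_ ?_ ?_ ?_
      · simp [Fin.sum_univ_four]; omega
      · simp [Fin.sum_univ_four]; omega
      · intro i; fin_cases i <;> simp <;> omega
      · simp [Fin.sum_univ_four]; omega
      · omega
      · simp [Fin.sum_univ_four]; omega
      · intro i; fin_cases i <;> simp [Fin.sum_univ_four] <;> omega
      · simp [Fin.sum_univ_four]
        linear_combination h + j * hνs - 2 * j * hρ
    · obtain ⟨c, rfl⟩ : ∃ c, j = m + 1 + c := ⟨j - (m + 1), by omega⟩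
      refine hg' (2 * c + 1) ![c + 1, c + 1, c, c] ?_ ?_ ?_ ?_ ?_ ?_ ?_ ?_
      · simp [Fin.sum_univ_four]; omega
      · simp [Fin.sum_univ_four]; omega
      · intro i; fin_cases i <;> simp <;> omega
      · simp [Fin.sum_univ_four]; omega
      · omega
      · simp [Fin.sum_univ_four]; omega
      · intro i; fin_cases i <;> simp [Fin.sum_univ_four] <;> omega
      · push_cast at h
        simp [Fin.sum_univ_four]
        linear_combination h + c * hνs - (2 * c + 1) * hρ
  obtain ⟨Q, T, hQ, hQt, hT, hTt, hQT⟩ := core_exist m μ α ρ δ hρ (sub_ne_zero.2 (hab 0))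
    (fun i => sub_ne_zero.2 (hab i.succ).symm) hν hνs hδ
  let e : Fin 4 × Fin (m + 1) ≃ Fin (4 * (m + 1)) := finProdFinEquiv
  let P' : Fin 5 → Matrix (Fin 4 × Fin (m + 1)) (Fin 4 × Fin (m + 1)) ℂ := Fin.cons T Q
  have hP' : ∀ j, P' j * P' j = P' j := by
    intro j; refine Fin.cases ?_ (fun i => ?_) j
    · exact hT
    · exact hQ i
  have hPt' : ∀ j, (P' j).trace = s j := by
    intro j; refine Fin.cases ?_ (fun i => ?_) j
    · rw [hs0]; push_cast; exact hTt
    · rw [hs1]; push_cast; exact hQt i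
  have hPs' : ∑ j, (a j • (1 : Matrix (Fin 4 × Fin (m + 1)) (Fin 4 × Fin (m + 1)) ℂ) + (b j - a j) • P' j) = 0 := by
    rw [Fin.sum_univ_succ]
    simp only [P', Fin.cons_zero, Fin.cons_succ, Finset.sum_add_distrib, ← Finset.sum_smul]
    change a 0 • _ + (b 0 - a 0) • T + (C • _ + ∑ i, μ i • Q i) = 0
    rw [hQT]
    simp only [α, ρ]
    module
  let P : Fin 5 → Matrix (Fin (4 * (m + 1))) (Fin (4 * (m + 1))) ℂ :=
    fun j => (P' j).submatrix e.symm e.symm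
  have hP : ∀ j, P j * P j = P j := by
    intro j; simp only [P]; rw [submatrix_mul_equiv, hP']
  have hPt : ∀ j, (P j).trace = s j := by
    intro j; rw [← hPt']
    exact Equiv.sum_comp e.symm (fun i => P' j i i)
  have hPs : ∑ j, (a j • (1 : Matrix (Fin (4 * (m + 1))) (Fin (4 * (m + 1))) ℂ) + (b j - a j) • P j) = 0 := by
    have := congrArg (fun M => M.submatrix e.symm e.symm) hPs'
    simp only [Fin.sum_univ_five, submatrix_add, submatrix_smul, Pi.add_apply, Pi.smul_apply,
      submatrix_one_equiv, submatrix_zero, Pi.zero_apply] at this ⊢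
    exact this
  exact ⟨_, hPs, irred_of_generic_s11 d hgen a b hab r s hrs hr hs P hP hPt hPs, fun j =>
    conj_of_idem (d j) (a j) (b j) (hab j) (hval j) (P j) (hP j) (by rw [hPt, hs])⟩
end

section
/- Let n ≥ 2. For every choice of generic eigenvalues compatible with the (n+1)-tuple of multiplicity vectors [n−1,1] : Λ₁ = Λ₂ = … = Λ_{n+1} = (n−1, 1), there exists an irreducible (n+1)-tuple of diagonalizable matrices A₁,…,A_{n+1} ∈ gl(n,ℂ) with A₁ + … + A_{n+1} = 0, where each A_j has two distinct eigenvalues with multiplicities n−1 and 1 equal to the chosen generic eigenvalues. (This tuple of multiplicity vectors is rigid: Σ_j d_j = (n+1)(2n−2) = 2n² − 2.) -/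
open Matrix BigOperators

theorem ev_extract {n : ℕ} (hn : 2 ≤ n) (d : Fin n → ℂ)
    (h : evCounts d = ({n - 1, 1} : Multiset ℕ)) :
    ∃ k m : Fin n, d m ≠ d k ∧ ∀ i, i ≠ k → d i = d m := by
  classical
  unfold evCounts at h
  have h1 : 1 ∈ ({n - 1, 1} : Multiset ℕ) := by simp
  rw [← h] at h1
  obtain ⟨s, hs, hs1⟩ := Multiset.mem_map.1 h1
  obtain ⟨k, hk⟩ := Finset.card_eq_one.1 hs1
  have hcard : (Finset.univ.image d).card = 2 := by
    have := congrArg Multiset.card h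
    rw [Multiset.card_map] at this
    exact this
  have hs' : s ∈ Finset.univ.image d := hs
  have he : ((Finset.univ.image d).erase s).card = 1 := by
    rw [Finset.card_erase_of_mem hs', hcard]
  obtain ⟨b, hb⟩ := Finset.card_eq_one.1 he
  have hkk : d k = s := by
    have : k ∈ Finset.univ.filter (fun k => d k = s) := by rw [hk]; simp
    simpa using this
  have hbm : b ∈ (Finset.univ.image d).erase s := by rw [hb]; simp
  obtain ⟨hbs, hbi⟩ := Finset.mem_erase.1 hbm
  obtain ⟨m, -, hm⟩ := Finset.mem_image.1 hbi
  refine ⟨k, m, by rw [hm, hkk]; exact hbs, fun i hi => ?_⟩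
  have his : d i ≠ s := by
    intro hc
    have : i ∈ Finset.univ.filter (fun k => d k = s) := by simp [hc]
    rw [hk] at this
    exact hi (by simpa using this)
  have : d i ∈ (Finset.univ.image d).erase s :=
    Finset.mem_erase.2 ⟨his, Finset.mem_image_of_mem _ (Finset.mem_univ _)⟩
  rw [hb] at this
  rw [hm]; simpa using this

theorem conj_rank_one {n : ℕ} (d : Fin n → ℂ) (k : Fin n) (a c : ℂ) (hc : c ≠ 0)
    (hk : d k = a + c) (hd : ∀ i, i ≠ k → d i = a) (u v : Fin n → ℂ) (huv : v ⬝ᵥ u = c) :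
    MatConj (Matrix.diagonal d) (a • (1 : Matrix (Fin n) (Fin n) ℂ) + vecMulVec u v) := by
  classical
  obtain ⟨m, hm⟩ : ∃ m, u m ≠ 0 := by
    by_contra! hcon
    apply hc
    rw [← huv]
    simp [dotProduct, hcon]
  let σ := Equiv.swap k m
  have hσ : σ k = m := Equiv.swap_apply_left k m
  let S : Matrix (Fin n) (Fin n) ℂ := Matrix.of fun l i =>
    if i = k then u l else (if l = σ i then 1 else 0) - v (σ i) / c * u l
  have hvS : v ᵥ* S = Pi.single k c := by
    funext i
    by_cases hi : i = k
    · subst hi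
      simp [vecMul, dotProduct, S]
      simpa [dotProduct] using huv
    · simp only [vecMul, dotProduct, S, Matrix.of_apply, hi, if_false, mul_sub,
        Finset.sum_sub_distrib, Pi.single_apply]
      have : ∑ x, v x * (v (σ i) / c * u x) = v (σ i) / c * ∑ x, v x * u x := by
        rw [Finset.mul_sum]; exact Finset.sum_congr rfl fun _ _ => by ring
      rw [this]
      have h2 : ∑ x, v x * u x = c := huv
      rw [h2]
      simp [hc]
  have hinj : Function.Injective S.mulVec := by
    rw [← Matrix.coe_mulVecLin, ← LinearMap.ker_eq_bot, LinearMap.ker_eq_bot']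
    intro x hx
    rw [Matrix.mulVecLin_apply] at hx
    have hxk : x k = 0 := by
      have := congrArg (fun y => v ⬝ᵥ y) hx
      simp only [Matrix.dotProduct_mulVec, hvS, dotProduct_zero, single_dotProduct] at this
      simpa [hc] using this
    have hl : ∀ l, x (σ.symm l) = (∑ i, x i * (v (σ i) / c)) * u l := by
      intro l
      have h0 := congrFun hx l
      have h1 : (S *ᵥ x) l = ∑ i, ((if l = σ i then x i else 0) - x i * (v (σ i) / c) * u l) := by
        simp only [mulVec, dotProduct, S, Matrix.of_apply]
        refine Finset.sum_congr rfl fun i _ => ?_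
        by_cases hi : i = k
        · subst hi; simp [hxk]
        · simp only [hi, if_false]
          split_ifs <;> ring
      rw [h1, Finset.sum_sub_distrib, ← Finset.sum_mul] at h0
      have h3 : ∑ i, (if l = σ i then x i else 0) = x (σ.symm l) := by
        simp [← Equiv.symm_apply_eq]
      rw [h3] at h0
      exact sub_eq_zero.1 h0
    have hs : ∑ i, x i * (v (σ i) / c) = 0 := by
      have := hl m
      rw [← hσ, Equiv.symm_apply_apply, hxk, hσ] at this
      rcases mul_eq_zero.1 this.symm with h | h
      · exact h
      · exact absurd h hm
    funext i
    have := hl (σ i)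
    simpa [hs] using this
  obtain ⟨T, hT⟩ := Matrix.mulVec_injective_iff_isUnit.1 hinj
  refine ⟨T, ?_⟩
  rw [Units.eq_mul_inv_iff_mul_eq, hT, add_mul, smul_mul_assoc, one_mul, vecMulVec_mul, hvS]
  ext l i
  rw [Matrix.mul_diagonal, Matrix.add_apply, Matrix.smul_apply, vecMulVec_apply]
  by_cases hi : i = k
  · subst hi
    simp [S, hk]; ring
  · rw [hd i hi]
    simp [hi, mul_comm]

/-- existence of the rigid series `[n-1,1]`: `n+1` multiplicity vectors all
equal to `(n-1,1)`. -/
theorem stmt13 (n : ℕ) (hn : 2 ≤ n)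
    (d : Fin (n + 1) → Fin n → ℂ)
    (hmv : ∀ j, evCounts (d j) = ({n - 1, 1} : Multiset ℕ))
    (hsum : (∑ j, ∑ i, d j i) = 0)
    (hgen : GenericAddEV d) :
    ∃ A : Fin (n + 1) → Matrix (Fin n) (Fin n) ℂ,
      (∑ j, A j) = 0 ∧ IrreducibleTuple A ∧
      ∀ j, MatConj (Matrix.diagonal (d j)) (A j) := by
  classical
  choose k m hkm hd using fun j => ev_extract hn (d j) (hmv j)
  have hg : ∀ g : Fin (n + 1) → Fin n, ∑ j, d j (g j) ≠ 0 := by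
    intro g
    have := hgen 1 le_rfl (by omega) (fun j => {g j}) (by simp)
    simpa using this
  obtain ⟨al, hal⟩ : ∃ al : Fin (n + 1) → ℂ, ∀ j, al j = d j (m j) := ⟨_, fun _ => rfl⟩
  obtain ⟨c, hc⟩ : ∃ c : Fin (n + 1) → ℂ, ∀ j, c j = d j (k j) - al j := ⟨_, fun _ => rfl⟩
  obtain ⟨a, ha⟩ : ∃ a : ℂ, a = ∑ j, al j := ⟨_, rfl⟩
  have ha0 : a ≠ 0 := by
    rw [ha]; simp only [hal]; exact hg m
  have hc0 : ∀ j, c j ≠ 0 := fun j => by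
    rw [hc, hal]; exact sub_ne_zero.2 (hkm j).symm
  have hac : ∀ j, a + c j ≠ 0 := by
    intro j
    have h1 := hg (Function.update m j (k j))
    have h2 : ∑ i, d i (Function.update m j (k j) i) = ∑ i, (al i + if i = j then c i else 0) := by
      refine Finset.sum_congr rfl fun i _ => ?_
      by_cases hi : i = j
      · subst hi; simp [hc]
      · simp [hi, hal]
    rw [h2, Finset.sum_add_distrib, ← ha] at h1
    simpa using h1
  have hcs : n * a + ∑ j, c j = 0 := by
    have h2 : ∀ j, ∑ i, d j i = n * al j + c j := by
      intro j
      have : ∀ i, d j i = al j + if i = k j then c j else 0 := by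
        intro i
        by_cases hi : i = k j
        · simp [hi, hc]
        · simp [hi, hal, hd j i hi]
      simp [this, Finset.sum_add_distrib]
    rw [← hsum, Finset.sum_congr rfl fun j _ => h2 j, Finset.sum_add_distrib, ← Finset.mul_sum, ha]
  let w : Fin n → ℂ := fun i => a + c i.castSucc
  let u : Fin (n + 1) → Fin n → ℂ :=
    Fin.snoc (α := fun _ => Fin n → ℂ) (fun j => Pi.single j 1) (fun _ => -1)
  let v : Fin (n + 1) → Fin n → ℂ :=
    Fin.snoc (α := fun _ => Fin n → ℂ) (fun j => w - Pi.single j a) w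
  have hu1 : ∀ j : Fin n, u j.castSucc = Pi.single j 1 := fun j => by simp [u]
  have hu2 : u (Fin.last n) = fun _ => -1 := by simp [u]
  have hv1 : ∀ j : Fin n, v j.castSucc = w - Pi.single j a := fun j => by simp [v]
  have hv2 : v (Fin.last n) = w := by simp [v]
  have hwu : w ⬝ᵥ (fun _ => (-1 : ℂ)) = c (Fin.last n) := by
    rw [Fin.sum_univ_castSucc] at hcs
    simp [dotProduct, w, Finset.sum_add_distrib]
    linear_combination -hcs
  have huv : ∀ j, v j ⬝ᵥ u j = c j := by
    intro j
    refine Fin.lastCases ?_ (fun j => ?_) j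
    · rw [hu2, hv2, hwu]
    · rw [hu1, hv1]; simp [w]
  have huv0 : ∀ i j, v i ⬝ᵥ u j ≠ 0 := by
    intro i j
    by_cases hij : i = j
    · subst hij; rw [huv]; exact hc0 i
    revert hij
    refine Fin.lastCases ?_ (fun i => ?_) i <;> refine Fin.lastCases ?_ (fun j => ?_) j <;>
      intro hij
    · exact absurd rfl hij
    · rw [hv2, hu1]; simpa [w] using hac j.castSucc
    · rw [hv1, hu2, sub_dotProduct, hwu]
      have := hac (Fin.last n)
      rw [add_comm] at this
      simpa using this
    · have hne : j ≠ i := fun h => hij (by rw [h])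
      rw [hv1, hu1]; simpa [w, hne] using hac j.castSucc
  have hS : ∑ j, vecMulVec (u j) (v j) = (-a) • (1 : Matrix (Fin n) (Fin n) ℂ) := by
    rw [Fin.sum_univ_castSucc, hu2, hv2]
    ext p q
    simp only [hu1, hv1, Matrix.add_apply, Matrix.sum_apply, vecMulVec_apply, Pi.single_apply,
      Matrix.smul_apply, Matrix.one_apply]
    by_cases hpq : p = q
    · subst hpq; simp; ring
    · simp [hpq, Ne.symm hpq]
  refine ⟨fun j => al j • (1 : Matrix (Fin n) (Fin n) ℂ) + vecMulVec (u j) (v j), ?_, ?_, ?_⟩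
  · rw [Finset.sum_add_distrib, hS, ← Finset.sum_smul, ← ha]; simp
  · intro V hV
    have hR : ∀ j, ∀ x ∈ V, (v j ⬝ᵥ x) • u j ∈ V := by
      intro j x hx
      have h1 := hV j (Submodule.mem_map_of_mem hx)
      rw [Matrix.mulVecLin_apply, Matrix.add_mulVec, Matrix.smul_mulVec, Matrix.one_mulVec,
        Matrix.vecMulVec_mulVec] at h1
      have h2 := V.sub_mem h1 (V.smul_mem (al j) hx)
      rw [add_sub_cancel_left] at h2
      simpa using h2
    by_cases hex : ∃ j, ∃ x ∈ V, v j ⬝ᵥ x ≠ 0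
    · right
      obtain ⟨j, x, hx, hjx⟩ := hex
      have huj : u j ∈ V := (V.smul_mem_iff hjx).1 (hR j x hx)
      have hall : ∀ i, u i ∈ V := fun i => (V.smul_mem_iff (huv0 i j)).1 (hR i _ huj)
      rw [eq_top_iff]
      intro y _
      rw [pi_eq_sum_univ' y]
      refine V.sum_mem fun i _ => V.smul_mem _ ?_
      have := hall i.castSucc
      rw [hu1] at this
      convert this using 1
    · left
      push Not at hex
      rw [eq_bot_iff]
      intro x hx
      have h1 := congrArg (fun M => M *ᵥ x) hS
      simp only [Matrix.sum_mulVec, Matrix.vecMulVec_mulVec, hex _ x hx, Matrix.smul_mulVec,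
        Matrix.one_mulVec] at h1
      simp at h1
      simpa [ha0] using h1
  · intro j
    refine conj_rank_one (d j) (k j) (al j) (c j) (hc0 j) (by rw [hc]; ring) ?_ _ _ (huv j)
    intro i hi
    rw [hal, hd j i hi]
end

section
/- Suppose there exists an irreducible (p+1)-tuple of diagonalizable matrices A₁,…,A_{p+1} ∈ gl(n,ℂ) with A₁ + … + A_{p+1} = 0, with generic eigenvalues, none of the A_j scalar, which is rigid (i.e., the dimensions of the conjugacy classes satisfy d₁ + … + d_{p+1} = 2n² − 2), and such that the maximal eigenvalue multiplicity of A₁ equals 2. Then p ≤ 3; moreover, if p = 3, then one of the matrices A_j has exactly two distinct eigenvalues, of multiplicities n−1 and 1. -/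
open Matrix BigOperators

/-- The dimension of the conjugacy class of `A` : `n² - dim (centralizer of A)`. -/
noncomputable def classDim {n : ℕ} (A : Matrix (Fin n) (Fin n) ℂ) : ℕ :=
  n ^ 2 - Module.finrank ℂ
    (LinearMap.ker (LinearMap.mulLeft ℂ A - LinearMap.mulRight ℂ A))

/-- Multiplicity of the value `σ` in the family `d`. -/
noncomputable def multOf {n : ℕ} (d : Fin n → ℂ) (σ : ℂ) : ℕ := by
  classical exact (Finset.univ.filter fun k => d k = σ).card

/-- Number of `k` with `d k ≠ σ`. -/
noncomputable def coMult {n : ℕ} (d : Fin n → ℂ) (σ : ℂ) : ℕ := by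
  classical exact (Finset.univ.filter fun k => ¬ d k = σ).card

/-- Number of pairs with equal values. -/
noncomputable def eqPairs {n : ℕ} (d : Fin n → ℂ) : ℕ := by
  classical exact (Finset.univ.filter fun x : Fin n × Fin n => d x.1 = d x.2).card

lemma mult_add {n : ℕ} (d : Fin n → ℂ) (σ : ℂ) : multOf d σ + coMult d σ = n := by
  classical
  unfold multOf coMult
  have h := Finset.card_filter_add_card_filter_not (s := (Finset.univ : Finset (Fin n)))
    (fun k => d k = σ)
  simp only [Finset.card_univ, Fintype.card_fin] at h
  convert h using 2

lemma eqPairs_eq_sum {n : ℕ} (d : Fin n → ℂ) : eqPairs d = ∑ i, multOf d (d i) := by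
  classical
  unfold eqPairs multOf
  simp only [Finset.card_filter]
  rw [Fintype.sum_prod_type]
  refine Finset.sum_congr rfl fun i _ => Finset.sum_congr rfl fun k _ => ?_
  simp only [eq_comm]

lemma eqPairs_le {n : ℕ} (d : Fin n → ℂ) (m : ℕ) (h : ∀ i, multOf d (d i) ≤ m) :
    eqPairs d ≤ n * m := by
  rw [eqPairs_eq_sum]
  calc ∑ i, multOf d (d i) ≤ ∑ _i : Fin n, m := Finset.sum_le_sum fun i _ => h i
    _ = n * m := by simp

lemma eqPairs_le' {n : ℕ} (d : Fin n → ℂ) (σ : ℂ) :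
    eqPairs d ≤ multOf d σ * multOf d σ + coMult d σ * coMult d σ := by
  classical
  unfold eqPairs multOf coMult
  rw [← Finset.card_product, ← Finset.card_product]
  refine le_trans (Finset.card_le_card ?_) (Finset.card_union_le _ _)
  intro x hx
  simp only [Finset.mem_filter, Finset.mem_univ, true_and, Finset.mem_union,
    Finset.mem_product] at hx ⊢
  by_cases h : d x.1 = σ
  · left; exact ⟨h, hx ▸ h⟩
  · right; exact ⟨h, hx ▸ h⟩

lemma centralizer_le {n : ℕ} (d : Fin n → ℂ) (A : Matrix (Fin n) (Fin n) ℂ)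
    (h : MatConj (Matrix.diagonal d) A) :
    Module.finrank ℂ (LinearMap.ker (LinearMap.mulLeft ℂ A - LinearMap.mulRight ℂ A))
      ≤ eqPairs d := by
  classical
  obtain ⟨S, hS⟩ := h
  let f : Matrix (Fin n) (Fin n) ℂ →ₗ[ℂ] ({x : Fin n × Fin n // d x.1 = d x.2} → ℂ) :=
    { toFun := fun X x => ((S⁻¹).val * X * S.val) x.1.1 x.1.2
      map_add' := by
        intro X Y; ext x; simp [mul_add, add_mul]
      map_smul' := by
        intro c X; ext x; simp }
  have hinj : Function.Injective
      (f ∘ₗ (LinearMap.ker (LinearMap.mulLeft ℂ A - LinearMap.mulRight ℂ A)).subtype) := by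
    rw [← LinearMap.ker_eq_bot, LinearMap.ker_eq_bot']
    rintro ⟨X, hX⟩ hf
    have hX' : A * X = X * A := by
      simpa [LinearMap.mem_ker, sub_eq_zero] using hX
    set Y := (S⁻¹).val * X * S.val with hY
    have hcomm : Matrix.diagonal d * Y = Y * Matrix.diagonal d := by
      have h1 : (S⁻¹).val * (A * X) * S.val = (S⁻¹).val * (X * A) * S.val := by rw [hX']
      rw [hS] at h1
      have e1 : (S⁻¹).val * (S.val * Matrix.diagonal d * (S⁻¹).val * X) * S.val
          = ((S⁻¹).val * S.val) * Matrix.diagonal d * Y := by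
        rw [hY]; simp only [mul_assoc]
      have e2 : (S⁻¹).val * (X * (S.val * Matrix.diagonal d * (S⁻¹).val)) * S.val
          = Y * Matrix.diagonal d * ((S⁻¹).val * S.val) := by
        rw [hY]; simp only [mul_assoc]
      rw [e1, e2, Units.inv_mul, one_mul, mul_one] at h1
      exact h1
    have hY0 : Y = 0 := by
      ext i k
      by_cases hik : d i = d k
      · exact congrFun hf ⟨(i, k), hik⟩
      · have := congrFun (congrFun hcomm i) k
        rw [Matrix.diagonal_mul, Matrix.mul_diagonal, mul_comm] at this
        have h2 : Y i k * (d i - d k) = 0 := by rw [mul_sub, this, sub_self]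
        rcases mul_eq_zero.mp h2 with h3 | h3
        · exact h3
        · exact absurd (sub_eq_zero.mp h3) hik
    have : X = S.val * Y * (S⁻¹).val := by
      rw [hY]
      have : S.val * ((S⁻¹).val * X * S.val) * (S⁻¹).val
        = (S.val * (S⁻¹).val) * X * (S.val * (S⁻¹).val) := by simp only [mul_assoc]
      rw [this, Units.mul_inv, one_mul, mul_one]
    apply Subtype.ext
    change X = 0
    rw [this, hY0]; simp
  have := LinearMap.finrank_le_finrank_of_injective hinj
  refine this.trans (le_of_eq ?_)
  rw [Module.finrank_fintype_fun_eq_card, Fintype.card_subtype]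
  unfold eqPairs
  congr

lemma exists_max {n : ℕ} (hn : 0 < n) (d : Fin n → ℂ) :
    ∃ i, ∀ k, multOf d (d k) ≤ multOf d (d i) := by
  have : Nonempty (Fin n) := ⟨⟨0, hn⟩⟩
  exact Finite.exists_max (fun i => multOf d (d i))

lemma coMult_pos {n : ℕ} (d : Fin n → ℂ) (A : Matrix (Fin n) (Fin n) ℂ)
    (h : MatConj (Matrix.diagonal d) A)
    (hns : ¬∃ c : ℂ, A = c • (1 : Matrix (Fin n) (Fin n) ℂ)) (σ : ℂ) : 1 ≤ coMult d σ := by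
  classical
  by_contra hc
  have h0 : coMult d σ = 0 := by omega
  unfold coMult at h0
  rw [Finset.card_eq_zero, Finset.filter_eq_empty_iff] at h0
  have hd : d = fun _ => σ := by
    ext k; have := h0 (Finset.mem_univ k); push Not at this; exact this
  apply hns
  obtain ⟨S, hS⟩ := h
  refine ⟨σ, ?_⟩
  have : Matrix.diagonal d = σ • (1 : Matrix (Fin n) (Fin n) ℂ) := by
    rw [hd]; ext i k; simp [Matrix.diagonal, Matrix.one_apply]
  rw [hS, this]
  simp

lemma beta {n p : ℕ} (hn : 2 ≤ n)
    (A : Fin (p + 1) → Matrix (Fin n) (Fin n) ℂ)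
    (d : Fin (p + 1) → Fin n → ℂ)
    (hdiag : ∀ j, MatConj (Matrix.diagonal (d j)) (A j))
    (hsum : (∑ j, A j) = 0)
    (hirr : IrreducibleTuple A) (l : Fin p → ℂ) :
    n ≤ ∑ j : Fin p, coMult (d j.succ) (l j) := by
  classical
  choose S hS using hdiag
  let f : (Fin n → ℂ) →ₗ[ℂ] ((Σ j : Fin p, {k : Fin n // ¬ d j.succ k = l j}) → ℂ) :=
    { toFun := fun v x => ((S x.1.succ)⁻¹.val *ᵥ v) x.2.1
      map_add' := by intro v w; ext x; simp [Matrix.mulVec_add]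
      map_smul' := by intro c v; ext x; simp [Matrix.mulVec_smul] }
  have hinj : Function.Injective f := by
    rw [← LinearMap.ker_eq_bot, LinearMap.ker_eq_bot']
    intro v hv
    by_contra hv0
    have hA : ∀ j : Fin p, A j.succ *ᵥ v = l j • v := by
      intro j
      have h1 : Matrix.diagonal (d j.succ) *ᵥ ((S j.succ)⁻¹.val *ᵥ v)
          = l j • ((S j.succ)⁻¹.val *ᵥ v) := by
        ext k
        rw [Matrix.mulVec_diagonal]
        by_cases hk : d j.succ k = l j
        · rw [hk]; rfl
        · have : ((S j.succ)⁻¹.val *ᵥ v) k = 0 := congrFun hv ⟨j, k, hk⟩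
          rw [this, Pi.smul_apply, this, mul_zero, smul_zero]
      rw [hS, mul_assoc, ← Matrix.mulVec_mulVec, ← Matrix.mulVec_mulVec, h1,
        Matrix.mulVec_smul, Matrix.mulVec_mulVec, Units.mul_inv, Matrix.one_mulVec]
    have hA0 : A 0 *ᵥ v = (-∑ j, l j) • v := by
      have h1 : (∑ j, A j) *ᵥ v = 0 := by rw [hsum]; simp
      rw [Fin.sum_univ_succ, Matrix.add_mulVec, Matrix.sum_mulVec] at h1
      simp only [hA] at h1
      rw [← Finset.sum_smul] at h1
      rw [neg_smul]
      exact eq_neg_of_add_eq_zero_left h1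
    have hall : ∀ j, ∃ c : ℂ, A j *ᵥ v = c • v := by
      intro j
      refine Fin.cases ⟨_, hA0⟩ (fun j => ⟨_, hA j⟩) j
    have hinv : ∀ j, (Submodule.span ℂ {v}).map (Matrix.mulVecLin (A j)) ≤ Submodule.span ℂ {v} := by
      intro j
      rw [Submodule.map_span_le]
      intro w hw
      rw [Set.mem_singleton_iff] at hw
      subst hw
      obtain ⟨c, hc⟩ := hall j
      rw [Matrix.mulVecLin_apply, hc]
      exact Submodule.smul_mem _ _ (Submodule.mem_span_singleton_self _)
    rcases hirr (Submodule.span ℂ {v}) hinv with h | h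
    · exact hv0 (Submodule.span_singleton_eq_bot.mp h)
    · have h1 := finrank_span_singleton (K := ℂ) hv0
      rw [h, finrank_top, Module.finrank_fintype_fun_eq_card, Fintype.card_fin] at h1
      omega
  have := LinearMap.finrank_le_finrank_of_injective hinj
  rw [Module.finrank_fintype_fun_eq_card, Module.finrank_fintype_fun_eq_card, Fintype.card_fin,
    Fintype.card_sigma] at this
  refine this.trans (le_of_eq ?_)
  refine Finset.sum_congr rfl fun j _ => ?_
  rw [Fintype.card_subtype]
  unfold coMult
  congr

lemma evCounts_of_one {n : ℕ} (d : Fin n → ℂ) (i : Fin n) (h : coMult d (d i) = 1) :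
    evCounts d = ({n - 1, 1} : Multiset ℕ) := by
  classical
  have hm := mult_add d (d i)
  have h' := h
  unfold coMult at h'
  obtain ⟨k, hk⟩ := Finset.card_eq_one.mp h'
  have hk' : ∀ x, ¬ d x = d i ↔ x = k := by
    intro x
    have := Finset.ext_iff.mp hk x
    simpa using this
  have hki : ¬ d k = d i := (hk' k).2 rfl
  have himg : Finset.univ.image d = {d i, d k} := by
    ext σ
    simp only [Finset.mem_image, Finset.mem_univ, true_and, Finset.mem_insert,
      Finset.mem_singleton]
    constructor
    · rintro ⟨x, rfl⟩
      by_cases hx : d x = d i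
      · left; exact hx
      · right; rw [(hk' x).1 hx]
    · rintro (rfl | rfl)
      · exact ⟨i, rfl⟩
      · exact ⟨k, rfl⟩
  have hm1 : multOf d (d i) = n - 1 := by omega
  have hm2 : multOf d (d k) = 1 := by
    unfold multOf
    rw [Finset.card_eq_one]
    refine ⟨k, ?_⟩
    ext x
    simp only [Finset.mem_filter, Finset.mem_univ, true_and, Finset.mem_singleton]
    constructor
    · intro hx
      apply (hk' x).1
      rw [hx]; exact hki
    · rintro rfl; rfl
  have hev : evCounts d = (Finset.univ.image d).val.map (multOf d) := by
    unfold evCounts multOf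
    congr
  rw [hev, himg, Finset.insert_val_of_notMem (by simpa using fun h => hki h.symm)]
  simp [hm1, hm2]

lemma mem_evCounts {n : ℕ} (d : Fin n → ℂ) (m : ℕ) :
    m ∈ evCounts d ↔ ∃ i, multOf d (d i) = m := by
  classical
  have hev : evCounts d = (Finset.univ.image d).val.map (multOf d) := by
    unfold evCounts multOf
    congr
  rw [hev]
  simp

lemma arith3_sorted (n a b c D : ℤ) (hc : 2 ≤ c) (hbc : c ≤ b) (hab : b ≤ a)
    (hs : n ≤ a + b + c) (hD : D ≤ n ^ 2 + 2 * n - 2)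
    (h1 : n * a + 2 * b * (n - b) + 2 * c * (n - c) ≤ D)
    (h2 : 2 * a * (n - a) + 2 * b * (n - b) + 2 * c * (n - c) ≤ D)
    (h3 : n * a + n * b + n * c ≤ D) (hn : 2 ≤ n) : False := by
  have hs2 : a + b + c ≤ n + 1 := by
    by_contra hcon
    nlinarith
  have hcase : n = a + b + c ∨ n = a + b + c - 1 := by omega
  rcases hcase with h | h
  · rcases le_or_gt (b + c) a with hy | hx
    · obtain ⟨y, hy'⟩ : ∃ y, a = b + c + y := ⟨a - b - c, by ring⟩
      have : 0 ≤ y := by omega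
      subst hy'
      subst h
      nlinarith [mul_nonneg (sub_nonneg.2 hc) (sub_nonneg.2 (hc.trans hbc)),
        mul_nonneg this (sub_nonneg.2 hc), mul_nonneg this (sub_nonneg.2 (hc.trans hbc))]
    · obtain ⟨x, hx'⟩ : ∃ x, a = b + c - x := ⟨b + c - a, by ring⟩
      have hx1 : 1 ≤ x := by omega
      have hxc : x ≤ c := by omega
      subst hx'
      subst h
      nlinarith [mul_nonneg (sub_nonneg.2 hbc) (sub_nonneg.2 hc),
        mul_nonneg (sub_nonneg.2 hxc) (sub_nonneg.2 hx1), mul_nonneg (sub_nonneg.2 hxc) (sub_nonneg.2 hc), sq_nonneg (c - 2)]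
  · rcases le_or_gt (b + c) a with hy | hx
    · obtain ⟨y, hy'⟩ : ∃ y, a = b + c + y := ⟨a - b - c, by ring⟩
      have : 0 ≤ y := by omega
      subst hy'
      subst h
      nlinarith [mul_nonneg (sub_nonneg.2 hc) (sub_nonneg.2 (hc.trans hbc)),
        mul_nonneg this (sub_nonneg.2 hc), mul_nonneg this (sub_nonneg.2 (hc.trans hbc))]
    · obtain ⟨x, hx'⟩ : ∃ x, a = b + c - x := ⟨b + c - a, by ring⟩
      have hx1 : 1 ≤ x := by omega
      have hxc : x ≤ c := by omega
      subst hx'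
      subst h
      nlinarith [mul_nonneg (sub_nonneg.2 hbc) (sub_nonneg.2 hc),
        mul_nonneg (sub_nonneg.2 hxc) (sub_nonneg.2 hx1), mul_nonneg (sub_nonneg.2 hxc) (sub_nonneg.2 hc), sq_nonneg (c - 2)]

lemma arith3 (n a b c D E F : ℤ) (ha : 2 ≤ a) (hb : 2 ≤ b) (hc : 2 ≤ c)
    (hs : n ≤ a + b + c) (hD : D + E + F ≤ n ^ 2 + 2 * n - 2)
    (a1 : n * a ≤ D) (a2 : 2 * a * (n - a) ≤ D)
    (b1 : n * b ≤ E) (b2 : 2 * b * (n - b) ≤ E)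
    (c1 : n * c ≤ F) (c2 : 2 * c * (n - c) ≤ F) (hn : 2 ≤ n) : False := by
  rcases le_total a b with h1 | h1 <;> rcases le_total b c with h2 | h2 <;>
    rcases le_total a c with h3 | h3
  · exact arith3_sorted n c b a (D + E + F) ha h1 h2 (by linarith) hD (by linarith) (by linarith)
      (by linarith) hn
  · exact arith3_sorted n c b a (D + E + F) ha h1 h2 (by linarith) hD (by linarith) (by linarith)
      (by linarith) hn
  · exact arith3_sorted n b c a (D + E + F) ha h3 h2 (by linarith) hD (by linarith) (by linarith)
      (by linarith) hn
  · exact arith3_sorted n b a c (D + E + F) hc h3 h1 (by linarith) hD (by linarith) (by linarith)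
      (by linarith) hn
  · exact arith3_sorted n c a b (D + E + F) hb h1 h3 (by linarith) hD (by linarith) (by linarith)
      (by linarith) hn
  · exact arith3_sorted n a c b (D + E + F) hb h2 h3 (by linarith) hD (by linarith) (by linarith)
      (by linarith) hn
  · exact arith3_sorted n a b c (D + E + F) hc h2 h1 (by linarith) hD (by linarith) (by linarith)
      (by linarith) hn
  · exact arith3_sorted n a b c (D + E + F) hc h2 h1 (by linarith) hD (by linarith) (by linarith)
      (by linarith) hn

lemma merge (n a b D E : ℤ) (ha : 1 ≤ a) (hb : 1 ≤ b)
    (a1 : n * a ≤ D) (a2 : 2 * a * (n - a) ≤ D)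
    (b1 : n * b ≤ E) (b2 : 2 * b * (n - b) ≤ E) :
    2 ≤ a + b ∧ n * (a + b) ≤ D + E ∧ 2 * (a + b) * (n - (a + b)) ≤ D + E := by
  refine ⟨by linarith, by linarith, by nlinarith [mul_pos (show 0 < a by linarith) (show 0 < b by linarith)]⟩

lemma arith_ones (n e D E F G : ℤ) (he : 1 ≤ e) (hs : n ≤ 3 + e)
    (hD : D + E + F + G ≤ n ^ 2 + 2 * n - 2)
    (a2 : 2 * (n - 1) ≤ D) (b2 : 2 * (n - 1) ≤ E) (c2 : 2 * (n - 1) ≤ F)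
    (e1 : n * e ≤ G) (e2 : 2 * e * (n - e) ≤ G) (hn : 2 ≤ n) : False := by
  by_cases h5 : 5 ≤ n
  · nlinarith
  · have he4 : e ≤ 4 := by
      by_contra hcon
      nlinarith
    have hn4 : n ≤ 4 := by omega
    interval_cases n <;> interval_cases e <;> omega

lemma arith4 (n a b c e D E F G : ℤ) (ha : 1 ≤ a) (hb : 1 ≤ b) (hc : 1 ≤ c) (he : 1 ≤ e)
    (hs : n ≤ a + b + c + e) (hD : D + E + F + G ≤ n ^ 2 + 2 * n - 2)
    (a1 : n * a ≤ D) (a2 : 2 * a * (n - a) ≤ D)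
    (b1 : n * b ≤ E) (b2 : 2 * b * (n - b) ≤ E)
    (c1 : n * c ≤ F) (c2 : 2 * c * (n - c) ≤ F)
    (e1 : n * e ≤ G) (e2 : 2 * e * (n - e) ≤ G) (hn : 2 ≤ n) : False := by
  have key : ∀ (a b c e D E F G : ℤ), 1 ≤ c → 1 ≤ e →
      n ≤ a + b + c + e → D + E + F + G ≤ n ^ 2 + 2 * n - 2 →
      n * a ≤ D → 2 * a * (n - a) ≤ D → n * b ≤ E → 2 * b * (n - b) ≤ E →
      n * c ≤ F → 2 * c * (n - c) ≤ F → n * e ≤ G → 2 * e * (n - e) ≤ G →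
      2 ≤ a → 2 ≤ b → False := by
    intro a b c e D E F G hc he hs hD a1 a2 b1 b2 c1 c2 e1 e2 ha hb
    obtain ⟨m0, m1, m2⟩ := merge n c e F G hc he c1 c2 e1 e2
    exact arith3 n a b (c + e) D E (F + G) ha hb m0 (by linarith) (by linarith) a1 a2 b1 b2 m1 m2 hn
  have dich : ∀ x : ℤ, 1 ≤ x → x = 1 ∨ 2 ≤ x := fun x hx => by omega
  by_cases hab : 2 ≤ a ∧ 2 ≤ b
  · exact key a b c e D E F G hc he hs hD a1 a2 b1 b2 c1 c2 e1 e2 hab.1 hab.2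
  by_cases hac : 2 ≤ a ∧ 2 ≤ c
  · exact key a c b e D F E G hb he (by linarith) (by linarith) a1 a2 c1 c2 b1 b2 e1 e2 hac.1 hac.2
  by_cases hae : 2 ≤ a ∧ 2 ≤ e
  · exact key a e b c D G E F hb hc (by linarith) (by linarith) a1 a2 e1 e2 b1 b2 c1 c2 hae.1 hae.2
  by_cases hbc : 2 ≤ b ∧ 2 ≤ c
  · exact key b c a e E F D G ha he (by linarith) (by linarith) b1 b2 c1 c2 a1 a2 e1 e2 hbc.1 hbc.2
  by_cases hbe : 2 ≤ b ∧ 2 ≤ e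
  · exact key b e a c E G D F ha hc (by linarith) (by linarith) b1 b2 e1 e2 a1 a2 c1 c2 hbe.1 hbe.2
  by_cases hce : 2 ≤ c ∧ 2 ≤ e
  · exact key c e a b F G D E ha hb (by linarith) (by linarith) c1 c2 e1 e2 a1 a2 b1 b2 hce.1 hce.2
  by_cases h2a : 2 ≤ a
  · obtain rfl : b = 1 := by omega
    obtain rfl : c = 1 := by omega
    obtain rfl : e = 1 := by omega
    exact arith_ones n a E F G D ha (by linarith) (by linarith) (by linarith) (by linarith)
      (by linarith) a1 a2 hn
  obtain rfl : a = 1 := by omega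
  by_cases h2b : 2 ≤ b
  · obtain rfl : c = 1 := by omega
    obtain rfl : e = 1 := by omega
    exact arith_ones n b D F G E hb (by linarith) (by linarith) (by linarith) (by linarith)
      (by linarith) b1 b2 hn
  obtain rfl : b = 1 := by omega
  by_cases h2c : 2 ≤ c
  · obtain rfl : e = 1 := by omega
    exact arith_ones n c D E G F hc (by linarith) (by linarith) (by linarith) (by linarith)
      (by linarith) c1 c2 hn
  obtain rfl : c = 1 := by omega
  exact arith_ones n e D E F G he (by linarith) (by linarith) (by linarith) (by linarith)
      (by linarith) e1 e2 hn

lemma merge_sum (n : ℤ) (q : ℕ) (r D : Fin (q + 1) → ℤ) (hr : ∀ j, 1 ≤ r j)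
    (h1 : ∀ j, n * r j ≤ D j) (h2 : ∀ j, 2 * r j * (n - r j) ≤ D j) :
    1 ≤ ∑ j, r j ∧ n * ∑ j, r j ≤ ∑ j, D j ∧
      2 * (∑ j, r j) * (n - ∑ j, r j) ≤ ∑ j, D j := by
  induction q with
  | zero => simpa using ⟨hr 0, h1 0, h2 0⟩
  | succ q ih =>
    obtain ⟨i0, i1, i2⟩ := ih (fun j => r j.succ) (fun j => D j.succ) (fun j => hr _)
      (fun j => h1 _) (fun j => h2 _)
    rw [Fin.sum_univ_succ r, Fin.sum_univ_succ D]
    obtain ⟨m0, m1, m2⟩ := merge n _ _ _ _ (hr 0) i0 (h1 0) (h2 0) i1 i2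
    exact ⟨by linarith, m1, m2⟩

/-- Theorem: rigid tuples with `u = 2` have `p ≤ 3`. If an irreducible
rigid `(p+1)`-tuple of diagonalizable matrices (none scalar) with generic eigenvalues sums to
`0` and the maximal eigenvalue multiplicity of `A 0` equals `2`, then `p ≤ 3`; and if `p = 3`,
one of the matrices has exactly two distinct eigenvalues, of multiplicities `n-1` and `1`. -/
theorem stmt15 (n p : ℕ)
    (A : Fin (p + 1) → Matrix (Fin n) (Fin n) ℂ)
    (d : Fin (p + 1) → Fin n → ℂ)
    (hdiag : ∀ j, MatConj (Matrix.diagonal (d j)) (A j))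
    (hsum : (∑ j, A j) = 0)
    (hirr : IrreducibleTuple A)
    (hgen : GenericAddEV d)
    (hns : ∀ j, ¬∃ c : ℂ, A j = c • (1 : Matrix (Fin n) (Fin n) ℂ))
    (hrig : (∑ j, classDim (A j)) = 2 * n ^ 2 - 2)
    (hmax2 : ∀ m ∈ evCounts (d 0), m ≤ 2)
    (hmax2' : 2 ∈ evCounts (d 0)) :
    p ≤ 3 ∧ (p = 3 → ∃ j, evCounts (d j) = ({n - 1, 1} : Multiset ℕ)) := by
  classical
  have hn2 : 2 ≤ n := by
    obtain ⟨i, hi⟩ := (mem_evCounts _ _).1 hmax2'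
    have := mult_add (d 0) (d 0 i)
    omega
  choose i hi using fun j => exists_max (by omega : 0 < n) (d j)
  have hpos : ∀ j, 1 ≤ coMult (d j) (d j (i j)) := fun j =>
    coMult_pos (d j) (A j) (hdiag j) (hns j) _
  have hbeta := beta hn2 A d hdiag hsum hirr (fun j => d j.succ (i j.succ))
  have hcl : ∀ j, (n : ℤ) ^ 2 - eqPairs (d j) ≤ classDim (A j) := by
    intro j
    have h := centralizer_le (d j) (A j) (hdiag j)
    unfold classDim
    have h' : n ^ 2 ≤ (n ^ 2 - Module.finrank ℂ
      (LinearMap.ker (LinearMap.mulLeft ℂ (A j) - LinearMap.mulRight ℂ (A j)))) + eqPairs (d j) := by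
      omega
    zify at h'
    push_cast
    linarith
  have hc0 : (n : ℤ) ^ 2 - 2 * n ≤ classDim (A 0) := by
    have h := eqPairs_le (d 0) 2 (fun k => hmax2 _ ((mem_evCounts _ _).2 ⟨k, rfl⟩))
    zify at h
    linarith [hcl 0]
  have hr1 : ∀ j, (n : ℤ) * coMult (d j) (d j (i j)) ≤ classDim (A j) := by
    intro j
    have h := eqPairs_le (d j) _ (hi j)
    have hm := mult_add (d j) (d j (i j))
    zify at h hm
    rw [eq_sub_of_add_eq hm] at h
    nlinarith [hcl j]
  have hr2 : ∀ j, 2 * (coMult (d j) (d j (i j)) : ℤ) * (n - coMult (d j) (d j (i j)))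
      ≤ classDim (A j) := by
    intro j
    have h := eqPairs_le' (d j) (d j (i j))
    have hm := mult_add (d j) (d j (i j))
    zify at h hm
    rw [eq_sub_of_add_eq hm] at h
    nlinarith [hcl j]
  set r : Fin (p + 1) → ℤ := fun j => (coMult (d j) (d j (i j)) : ℤ) with hrdef
  set D : Fin (p + 1) → ℤ := fun j => (classDim (A j) : ℤ) with hDdef
  have hS : (n : ℤ) ≤ ∑ j : Fin p, r j.succ := by
    simp only [hrdef]; exact_mod_cast hbeta
  have hT : ∑ j : Fin p, D j.succ ≤ (n : ℤ) ^ 2 + 2 * n - 2 := by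
    have h1 : (∑ j, classDim (A j)) + 2 = 2 * n ^ 2 := by
      have : 2 ^ 2 ≤ n ^ 2 := Nat.pow_le_pow_left hn2 2
      omega
    rw [Fin.sum_univ_succ] at h1
    zify at h1
    simp only [hDdef]
    linarith
  have hpos' : ∀ j, 1 ≤ r j := fun j => by
    simp only [hrdef]; exact_mod_cast hpos j
  have hr1' : ∀ j, (n : ℤ) * r j ≤ D j := hr1
  have hr2' : ∀ j, 2 * r j * (n - r j) ≤ D j := hr2
  have hnZ : (2 : ℤ) ≤ n := by exact_mod_cast hn2
  constructor
  · by_contra hp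
    obtain ⟨q, rfl⟩ : ∃ q, p = q + 1 + 1 + 1 + 1 := ⟨p - 4, by omega⟩
    obtain ⟨m0, m1, m2⟩ := merge_sum n q (fun j => r j.succ.succ.succ.succ)
      (fun j => D j.succ.succ.succ.succ) (fun j => hpos' _) (fun j => hr1' _) (fun j => hr2' _)
    rw [Fin.sum_univ_succ, Fin.sum_univ_succ, Fin.sum_univ_succ] at hS hT
    exact arith4 n (r (Fin.succ 0)) (r (Fin.succ 0).succ) (r (Fin.succ 0).succ.succ) _
      (D (Fin.succ 0)) (D (Fin.succ 0).succ) (D (Fin.succ 0).succ.succ) _ (hpos' _) (hpos' _) (hpos' _) m0 (by linarith) (by linarith)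
      (hr1' _) (hr2' _) (hr1' _) (hr2' _) (hr1' _) (hr2' _) m1 m2 hnZ
  · rintro rfl
    by_contra hcon
    push Not at hcon
    have h2 : ∀ j, 2 ≤ r j := by
      intro j
      by_contra hj
      have h1 : r j = 1 := le_antisymm (by linarith [not_le.1 hj]) (hpos' j)
      apply hcon j
      apply evCounts_of_one (d j) (i j)
      simp only [hrdef] at h1
      exact_mod_cast h1
    rw [Fin.sum_univ_three] at hS hT
    exact arith3 n _ _ _ _ _ _ (h2 _) (h2 _) (h2 _) hS hT
      (hr1' _) (hr2' _) (hr1' _) (hr2' _) (hr1' _) (hr2' _) hnZ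
end
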